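/- Let λ be an infinite cardinal number, let I be an index set with 2 ≤ |I| ≤ λ, and let (H_i)_{i ∈ I} be a family of nontrivial groups with |H_i| ≤ λ for all i ∈ I, such that at least one member of the family has cardinality exactly λ. Then there exists a simple group S of cardinality λ together with injective group homomorphisms φ_i : H_i → S for every i ∈ I, such that for all i, i' ∈ I with i ≠ i' and |H_{i'}| = λ, the group S is generated by the union of the images φ_i(H_i) and φ_{i'}(H_{i'}). -/

import Mathlib

universe u

set_option linter.unusedSectionVars false

namespace SparseRelators

open Function

variable {I : Type u} {H : I → Type u} [∀ i, Group (H i)] {U : Type u} {K : Type u}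

/-- The formal inverse of a letter of the free product of the `H i`. -/
def linv (l : Σ i, H i) : Σ i, H i := ⟨l.1, l.2⁻¹⟩

@[simp] theorem linv_fst (l : Σ i, H i) : (linv l).1 = l.1 := rfl

@[simp] theorem linv_linv (l : Σ i, H i) : linv (linv l) = l := by
  exact Sigma.ext rfl (heq_of_eq (inv_inv _))

theorem linv_eq_iff {l m : Σ i, H i} : linv l = m ↔ l = linv m :=
  ⟨fun h => by rw [← h, linv_linv], fun h => by rw [h, linv_linv]⟩

/-- A set of charts `H i → U` describes a partial free action of every `H i` on `U`: the charts are
parametrized orbits, and two charts of the same type have disjoint images or agree. -/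
structure IsAtlas (S : Set (Σ i, H i → U)) : Prop where
  inj : ∀ i e, (⟨i, e⟩ : Σ i, H i → U) ∈ S → Injective e
  disj : ∀ i e f, (⟨i, e⟩ : Σ i, H i → U) ∈ S → (⟨i, f⟩ : Σ i, H i → U) ∈ S →
    ∀ y z, e y = f z → e = f

/-- The point `p` lies in a chart of type `i`. -/
def Covers (S : Set (Σ i, H i → U)) (i : I) (p : U) : Prop :=
  ∃ e : H i → U, (⟨i, e⟩ : Σ i, H i → U) ∈ S ∧ ∃ y, e y = p

/-- The letter `l` maps `p` to `q` in the partial action described by `S`. -/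
def Step (S : Set (Σ i, H i → U)) (l : Σ i, H i) (p q : U) : Prop :=
  ∃ e : H l.1 → U, (⟨l.1, e⟩ : Σ i, H i → U) ∈ S ∧ ∃ y, e y = p ∧ e (l.2 * y) = q

section Step

variable {S T : Set (Σ i, H i → U)} {l : Σ i, H i} {p q r : U}

theorem Step.right_unique (hS : IsAtlas S) (h : Step S l p q) (h' : Step S l p r) : q = r := by
  obtain ⟨e, he, y, rfl, rfl⟩ := h
  obtain ⟨e', he', y', h1, rfl⟩ := h'
  obtain rfl := hS.disj _ _ _ he' he _ _ h1
  rw [hS.inj _ _ he' h1]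

theorem Step.inv (h : Step S l p q) : Step S (linv l) q p := by
  obtain ⟨e, he, y, rfl, rfl⟩ := h
  exact ⟨e, he, l.2 * y, rfl, congrArg e (inv_mul_cancel_left l.2 y)⟩

theorem Step.left_unique (hS : IsAtlas S) (h : Step S l p r) (h' : Step S l q r) : p = q :=
  h.inv.right_unique hS h'.inv

theorem Step.mono (hST : S ⊆ T) (h : Step S l p q) : Step T l p q := by
  obtain ⟨e, he, h⟩ := h
  exact ⟨e, hST he, h⟩

theorem Covers.mono (hST : S ⊆ T) {i : I} (h : Covers S i p) : Covers T i p := by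
  obtain ⟨e, he, h⟩ := h
  exact ⟨e, hST he, h⟩

theorem Step.covers_left (h : Step S l p q) : Covers S l.1 p := by
  obtain ⟨e, he, y, h, -⟩ := h
  exact ⟨e, he, y, h⟩

theorem Step.covers_right (h : Step S l p q) : Covers S l.1 q :=
  h.inv.covers_left

theorem Covers.exists_step (h : Covers S l.1 p) : ∃ q, Step S l p q := by
  obtain ⟨e, he, y, rfl⟩ := h
  exact ⟨_, e, he, y, rfl, rfl⟩

theorem Covers.exists_step_left (h : Covers S l.1 p) : ∃ q, Step S l q p := by
  obtain ⟨q, hq⟩ := Covers.exists_step (l := linv l) h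
  exact ⟨q, by simpa using hq.inv⟩

end Step

/-- Periodic words without long common subwords: `L κ` lists the letters of the relator `κ`
periodically, with period `200`. -/
structure IsSparse (L : K → ℤ → Σ i, H i) : Prop where
  periodic : ∀ κ z, L κ (z + 200) = L κ z
  ne_one : ∀ κ z, (L κ z).2 ≠ 1
  alternating : ∀ κ z, (L κ z).1 ≠ (L κ (z + 1)).1
  window : ∀ κ κ' z z', (∀ t : ℤ, 0 ≤ t → t < 12 → L κ (z + t) = L κ' (z' + t)) →
    κ = κ' ∧ (200 : ℤ) ∣ z - z'
  reverse : ∀ κ κ' z z', ¬ ∀ t : ℤ, 0 ≤ t → t < 12 → L κ (z + t) = linv (L κ' (z' - t))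

theorem IsSparse.periodic_of_dvd {L : K → ℤ → Σ i, H i} (hL : IsSparse L) {κ : K} {z z' : ℤ}
    (h : (200 : ℤ) ∣ z - z') : L κ z = L κ z' := by
  obtain ⟨k, hk⟩ := h
  obtain rfl : z = z' + k * 200 := by lia
  have hk : Periodic (L κ) (k * 200) := Periodic.int_mul (c := (200 : ℤ)) (hL.periodic κ) k
  rw [hk]

/-- A closed path in `S` reading the relator `κ`. -/
structure IsLoop (S : Set (Σ i, H i → U)) (L : K → ℤ → Σ i, H i) (κ : K) (r : ℤ → U) : Prop where
  step : ∀ z, Step S (L κ z) (r z) (r (z + 1))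
  periodic : ∀ z, r (z + 200) = r z

theorem IsLoop.eq_of_dvd {S : Set (Σ i, H i → U)} {L : K → ℤ → Σ i, H i} {κ : K} {r : ℤ → U}
    (h : IsLoop S L κ r) {z z' : ℤ} (hz : (200 : ℤ) ∣ z - z') : r z = r z' := by
  obtain ⟨k, hk⟩ := hz
  obtain rfl : z = z' + k * 200 := by lia
  exact Periodic.int_mul (f := r) (c := (200 : ℤ)) h.periodic k z'

theorem IsLoop.mono {S T : Set (Σ i, H i → U)} (hST : S ⊆ T) {L : K → ℤ → Σ i, H i} {κ : K}
    {r : ℤ → U} (h : IsLoop S L κ r) : IsLoop T L κ r :=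
  ⟨fun z => (h.step z).mono hST, h.periodic⟩

/-- `q` is a path in `S` reading the relator `κ` between the positions `s` and `t`. -/
def IsTrack (S : Set (Σ i, H i → U)) (L : K → ℤ → Σ i, H i) (κ : K) (s t : ℤ) (q : ℤ → U) : Prop :=
  ∀ z, s ≤ z → z < t → Step S (L κ z) (q z) (q (z + 1))

/-- Every path reading half a relator closes up. -/
def Rigid (S : Set (Σ i, H i → U)) (L : K → ℤ → Σ i, H i) : Prop :=
  ∀ κ s q, IsTrack S L κ s (s + 100) q → ∃ r, IsLoop S L κ r ∧ r s = q s

section Track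

variable {S : Set (Σ i, H i → U)} {L : K → ℤ → Σ i, H i} {κ : K} {s t : ℤ} {q r : ℤ → U}

theorem IsTrack.agree_left (hS : IsAtlas S) (hq : IsTrack S L κ s t q) (hr : IsTrack S L κ s t r)
    (n : ℕ) : ∀ z, s ≤ z - n → z ≤ t → q z = r z → q (z - n) = r (z - n) := by
  induction n with
  | zero => intro z _ _ h; simpa using h
  | succ n ih =>
    intro z hs ht h
    push_cast at *
    have h1 := ih z (by lia) ht h
    have e : z - n = z - (n + 1) + 1 := by ring
    have a := hq (z - (n + 1)) (by lia) (by lia)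
    have b := hr (z - (n + 1)) (by lia) (by lia)
    rw [← e] at a b
    rw [h1] at a
    exact a.left_unique hS b

theorem IsTrack.agree_right (hS : IsAtlas S) (hq : IsTrack S L κ s t q) (hr : IsTrack S L κ s t r)
    (n : ℕ) : ∀ z, s ≤ z → z + n ≤ t → q z = r z → q (z + n) = r (z + n) := by
  induction n with
  | zero => intro z _ _ h; simpa using h
  | succ n ih =>
    intro z hs ht h
    push_cast at *
    have h1 := ih z hs (by lia) h
    have a := hq (z + n) (by lia) (by lia)
    have b := hr (z + n) (by lia) (by lia)
    rw [h1] at a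
    rw [← add_assoc]
    exact a.right_unique hS b

theorem IsTrack.agree (hS : IsAtlas S) (hq : IsTrack S L κ s t q) (hr : IsTrack S L κ s t r)
    {z z' : ℤ} (hz : s ≤ z) (hz' : z ≤ t) (hw : s ≤ z') (hw' : z' ≤ t) (h : q z = r z) :
    q z' = r z' := by
  rcases le_total z z' with hle | hle
  · have := hq.agree_right hS hr (z' - z).toNat z hz (by lia) h
    have e : z + ((z' - z).toNat : ℤ) = z' := by lia
    rwa [e] at this
  · have := hq.agree_left hS hr (z - z').toNat z (by lia) hz' h
    have e : z - ((z - z').toNat : ℤ) = z' := by lia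
    rwa [e] at this

theorem IsLoop.isTrack (h : IsLoop S L κ r) : IsTrack S L κ s t r := fun z _ _ => h.step z

theorem IsTrack.shift (hL : IsSparse L) (hq : IsTrack S L κ s t q) {d : ℤ} (hd : (200 : ℤ) ∣ d) :
    IsTrack S L κ (s - d) (t - d) (fun z => q (z + d)) := by
  intro z h1 h2
  have := hq (z + d) (by lia) (by lia)
  rw [hL.periodic_of_dvd (z := z + d) (z' := z) (by simpa using hd)] at this
  have e : z + 1 + d = z + d + 1 := by ring
  simpa [e] using this

end Track

/-- A maximal path of `S` reading part of a relator, both of whose ends are free. -/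
structure Segment (S : Set (Σ i, H i → U)) (L : K → ℤ → Σ i, H i) (X : Set U) where
  rel : K
  s : ℤ
  t : ℤ
  q : ℤ → U
  le : s ≤ t
  lt : t < s + 100
  track : IsTrack S L rel s t q
  left : ¬ Covers S (L rel (s - 1)).1 (q s)
  right : ¬ Covers S (L rel t).1 (q t)
  mem_s : q s ∈ X
  mem_t : q t ∈ X

theorem exists_loop_or_segment {S : Set (Σ i, H i → U)} {L : K → ℤ → Σ i, H i} {X : Set U}
    (hS : IsAtlas S) (hR : Rigid S L) (hX : ∀ i p, Covers S i p → p ∈ X) (κ : K) (z : ℤ)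
    {p : U} (hp : p ∈ X) :
    (∃ r, IsLoop S L κ r ∧ r z = p) ∨
      ∃ f : Segment S L X, f.rel = κ ∧ f.s ≤ z ∧ z ≤ f.t ∧ f.q z = p := by
  classical
  let A : ℕ → Prop := fun m =>
    ∃ s t q, s ≤ z ∧ z ≤ t ∧ t - s = m ∧ IsTrack S L κ s t q ∧ q z = p
  have hA0 : A 0 := ⟨z, z, fun _ => p, le_rfl, le_rfl, by simp, fun w h1 h2 => by lia, rfl⟩
  by_cases hbig : ∃ m, 100 ≤ m ∧ A m
  · left
    obtain ⟨m, hm, s, t, q, hsz, hzt, hst, htr, hqz⟩ := hbig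
    obtain ⟨r, hr, hrs⟩ := hR κ s q (fun w h1 h2 => htr w h1 (by lia))
    refine ⟨r, hr, ?_⟩
    rw [← hqz]
    exact (hr.isTrack (s := s) (t := t)).agree hS htr le_rfl (hsz.trans hzt) hsz hzt hrs
  · right
    push Not at hbig
    have hspec := Nat.findGreatest_spec (P := A) (Nat.zero_le 100) hA0
    have hmax := fun k hk => Nat.findGreatest_is_greatest (P := A) (n := 100) (k := k) hk
    set m := Nat.findGreatest A 100
    have hm : m < 100 := by
      by_contra hcon
      exact hbig m (by lia) hspec
    have hnext : ¬ A (m + 1) := hmax (m + 1) (by lia) (by lia)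
    obtain ⟨s, t, q, hsz, hzt, hst, htr, hqz⟩ := hspec
    have hmemX : ∀ w, s ≤ w → w ≤ t → q w ∈ X := by
      intro w h1 h2
      rcases h2.lt_or_eq with h2 | rfl
      · exact hX _ _ (htr w h1 h2).covers_left
      · rcases h1.lt_or_eq with h1 | rfl
        · have := (htr (w - 1) (by lia) (by lia)).covers_right
          rw [sub_add_cancel] at this
          exact hX _ _ this
        · obtain rfl : s = z := by lia
          rwa [hqz]
    refine ⟨⟨κ, s, t, q, by lia, by lia, htr, ?_, ?_, hmemX s le_rfl (by lia),
      hmemX t (by lia) le_rfl⟩, rfl, hsz, hzt, hqz⟩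
    · intro hc
      obtain ⟨x, hx⟩ := hc.exists_step_left
      refine hnext ⟨s - 1, t, update q (s - 1) x, by lia, hzt, by push_cast; lia, ?_, ?_⟩
      · intro w h1 h2
        rcases h1.lt_or_eq with h1 | rfl
        · rw [update_of_ne (by lia), update_of_ne (by lia)]
          exact htr w (by lia) h2
        · rw [update_self, update_of_ne (by lia), sub_add_cancel]
          exact hx
      · rw [update_of_ne (by lia)]
        exact hqz
    · intro hc
      obtain ⟨x, hx⟩ := hc.exists_step
      refine hnext ⟨s, t + 1, update q (t + 1) x, hsz, by lia, by push_cast; lia, ?_, ?_⟩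
      · intro w h1 h2
        rcases (Int.lt_add_one_iff.1 h2).lt_or_eq with h2 | rfl
        · rw [update_of_ne (by lia), update_of_ne (by lia)]
          exact htr w (by lia) h2
        · rw [update_self, update_of_ne (by lia)]
          exact hx
      · rw [update_of_ne (by lia)]
        exact hqz

/-- A word starting at a point, along which new points will be attached. -/
structure Arm (H : I → Type u) (U : Type u) where
  base : U
  word : ℕ → Σ i, H i
  len : ℕ

namespace Arm

/-- The first `k` letters of the word of an arm, latest letter first. -/
def pre (a : Arm H U) : ℕ → List (Σ i, H i)
  | 0 => []
  | k + 1 => a.word k :: a.pre k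

@[simp] theorem pre_zero (a : Arm H U) : a.pre 0 = [] := rfl

theorem pre_succ (a : Arm H U) (k : ℕ) : a.pre (k + 1) = a.word k :: a.pre k := rfl

@[simp] theorem length_pre (a : Arm H U) (k : ℕ) : (a.pre k).length = k := by
  induction k with
  | zero => rfl
  | succ k ih => simp [pre_succ, ih]

theorem word_eq_of_pre_eq {a b : Arm H U} {k : ℕ} (h : a.pre k = b.pre k) :
    ∀ j < k, a.word j = b.word j := by
  induction k with
  | zero => intro j hj; lia
  | succ k ih =>
    intro j hj
    rw [pre_succ, pre_succ, List.cons.injEq] at h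
    rcases (Nat.lt_succ_iff.1 hj).lt_or_eq with hj | rfl
    · exact ih h.2 j hj
    · exact h.1

end Arm

/-- The data for one step of the construction: an atlas on `X`, room `N p l` for new points, and a
set of pairs of arms. The end points of the two arms of each pair will be identified. -/
structure ArmSystem (S : Set (Σ i, H i → U)) (X : Set U) (N : U → List (Σ i, H i) → U)
    (J : Set (Bool → Arm H U)) : Prop where
  isAtlas : IsAtlas S
  covers_mem : ∀ i p, Covers S i p → p ∈ X
  nil : ∀ p, N p [] = p
  inj : ∀ p ∈ X, ∀ p' ∈ X, ∀ l l', N p l = N p' l' → p = p' ∧ l = l'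
  base_mem : ∀ g ∈ J, ∀ σ, (g σ).base ∈ X
  le_len : ∀ g ∈ J, ∀ σ, 40 ≤ (g σ).len
  ne_one : ∀ g ∈ J, ∀ σ k, ((g σ).word k).2 ≠ 1
  alternating : ∀ g ∈ J, ∀ σ k, ((g σ).word k).1 ≠ ((g σ).word (k + 1)).1
  free : ∀ g ∈ J, ∀ σ, ¬ Covers S ((g σ).word 0).1 (g σ).base
  sep : ∀ g ∈ J, ∀ g' ∈ J, ∀ σ σ', (g σ).base = (g' σ').base →
    (∀ k < 12, (g σ).word k = (g' σ').word k) → g = g' ∧ σ = σ'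
  ends : ∀ g ∈ J, ((g false).word ((g false).len - 1)).1 ≠ ((g true).word ((g true).len - 1)).1

/-- The point after `k` letters on an arm, before the identification of end points. -/
def tip (N : U → List (Σ i, H i) → U) (a : Arm H U) (k : ℕ) : U := N a.base (a.pre k)

open Classical in
/-- The identification of the end points of arms. -/
noncomputable def glue (N : U → List (Σ i, H i) → U) (J : Set (Bool → Arm H U)) (x : U) : U :=
  if h : ∃ g ∈ J, x = tip N (g false) (g false).len then
    tip N (h.choose true) (h.choose true).len else x

open Classical in
/-- The points of the new chart of type `i` attached at `N p l`, before identifications. -/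
noncomputable def rawChart (N : U → List (Σ i, H i) → U) (p : U) (l : List (Σ i, H i)) (i : I)
    (y : H i) : U :=
  if y = 1 then N p l else N p (⟨i, y⟩ :: l)

/-- The places where new charts are attached. -/
def IsPlace (S : Set (Σ i, H i → U)) (X : Set U) (J : Set (Bool → Arm H U)) (p : U)
    (l : List (Σ i, H i)) (i : I) : Prop :=
  p ∈ X ∧ ((l = [] ∧ ¬ Covers S i p) ∨
    ∃ g ∈ J, ∃ σ, ∃ k < (g σ).len, p = (g σ).base ∧ l = (g σ).pre k ∧ i = ((g σ).word k).1)

/-- The enlarged atlas. -/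
def extend (S : Set (Σ i, H i → U)) (X : Set U) (N : U → List (Σ i, H i) → U)
    (J : Set (Bool → Arm H U)) : Set (Σ i, H i → U) :=
  S ∪ {c | ∃ p l i, IsPlace S X J p l i ∧ c = ⟨i, fun y => glue N J (rawChart N p l i y)⟩}

theorem mem_extend {S : Set (Σ i, H i → U)} {X : Set U} {N : U → List (Σ i, H i) → U}
    {J : Set (Bool → Arm H U)} {i : I} {e : H i → U} :
    (⟨i, e⟩ : Σ i, H i → U) ∈ extend S X N J ↔ ⟨i, e⟩ ∈ S ∨
      ∃ p l, IsPlace S X J p l i ∧ e = fun y => glue N J (rawChart N p l i y) := by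
  refine or_congr_right ⟨?_, ?_⟩
  · rintro ⟨p, l, j, h, he⟩
    obtain ⟨rfl, he⟩ := Sigma.mk.inj_iff.1 he
    exact ⟨p, l, h, eq_of_heq he⟩
  · rintro ⟨p, l, h, rfl⟩
    exact ⟨p, l, i, h, rfl⟩

theorem subset_extend {S : Set (Σ i, H i → U)} {X : Set U} {N : U → List (Σ i, H i) → U}
    {J : Set (Bool → Arm H U)} : S ⊆ extend S X N J :=
  Set.subset_union_left

/-- The points `p` and `q` are in the same chart of type `i`. -/
def SameChart (S : Set (Σ i, H i → U)) (i : I) (p q : U) : Prop :=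
  ∃ e : H i → U, (⟨i, e⟩ : Σ i, H i → U) ∈ S ∧ (∃ y, e y = p) ∧ ∃ y, e y = q

theorem Step.sameChart {S : Set (Σ i, H i → U)} {l : Σ i, H i} {p q : U} (h : Step S l p q) :
    SameChart S l.1 p q := by
  obtain ⟨e, he, y, h1, h2⟩ := h
  exact ⟨e, he, ⟨y, h1⟩, _, h2⟩

theorem SameChart.trans {S : Set (Σ i, H i → U)} (hS : IsAtlas S) {i : I} {p q r : U}
    (h : SameChart S i p q) (h' : SameChart S i q r) : SameChart S i p r := by
  obtain ⟨e, he, h1, ⟨y, h2⟩⟩ := h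
  obtain ⟨e', he', ⟨y', h3⟩, h4⟩ := h'
  obtain rfl := hS.disj _ _ _ he he' _ _ (h2.trans h3.symm)
  exact ⟨e, he, h1, h4⟩

theorem Step.letter_unique {S : Set (Σ i, H i → U)} (hS : IsAtlas S) {l m : Σ i, H i} {p q : U}
    (h : Step S l p q) (h' : Step S m p q) (hlm : l.1 = m.1) : l = m := by
  obtain ⟨i, a⟩ := l
  obtain ⟨j, b⟩ := m
  obtain rfl : i = j := hlm
  obtain ⟨e, he, y, rfl, h2⟩ := h
  obtain ⟨e', he', y', h3, h4⟩ := h'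
  obtain rfl := hS.disj _ _ _ he' he _ _ h3
  obtain rfl := hS.inj _ _ he' h3
  have := hS.inj _ _ he' (h2.trans h4.symm)
  exact congrArg (Sigma.mk i) (mul_right_cancel this)

theorem Step.eq_one {S : Set (Σ i, H i → U)} (hS : IsAtlas S) {l : Σ i, H i} {p : U}
    (h : Step S l p p) : l.2 = 1 := by
  obtain ⟨e, he, y, rfl, h2⟩ := h
  simpa using hS.inj _ _ he h2

namespace ArmSystem

variable {S : Set (Σ i, H i → U)} {X : Set U} {N : U → List (Σ i, H i) → U}
  {J : Set (Bool → Arm H U)}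

theorem eq_of_pre_eq (A : ArmSystem S X N J) {g g' : Bool → Arm H U} (hg : g ∈ J) (hg' : g' ∈ J)
    {σ σ' : Bool} {k k' : ℕ} (hk : 12 ≤ k) (hb : (g σ).base = (g' σ').base)
    (h : (g σ).pre k = (g' σ').pre k') : g = g' ∧ σ = σ' ∧ k = k' := by
  obtain rfl : k = k' := by simpa using congrArg List.length h
  obtain ⟨h1, h2⟩ := A.sep g hg g' hg' σ σ' hb
    fun j hj => Arm.word_eq_of_pre_eq h j (by lia)
  exact ⟨h1, h2, rfl⟩

theorem tip_inj (A : ArmSystem S X N J) {g g' : Bool → Arm H U} (hg : g ∈ J) (hg' : g' ∈ J)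
    {σ σ' : Bool} {k k' : ℕ} (hk : 12 ≤ k) (h : tip N (g σ) k = tip N (g' σ') k') :
    g = g' ∧ σ = σ' ∧ k = k' := by
  obtain ⟨h1, h2⟩ := A.inj _ (A.base_mem g hg σ) _ (A.base_mem g' hg' σ') _ _ h
  exact A.eq_of_pre_eq hg hg' hk h1 h2

theorem glue_end (A : ArmSystem S X N J) {g : Bool → Arm H U} (hg : g ∈ J) :
    glue N J (tip N (g false) (g false).len) = tip N (g true) (g true).len := by
  have h : ∃ g' ∈ J, tip N (g false) (g false).len = tip N (g' false) (g' false).len := ⟨g, hg, rfl⟩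
  have e : g = h.choose := (A.tip_inj hg h.choose_spec.1
    (by have := A.le_len g hg false; lia) h.choose_spec.2).1
  rw [glue, dif_pos h, ← e]

theorem glue_of_forall {x : U} (h : ∀ g ∈ J, x ≠ tip N (g false) (g false).len) :
    glue N J x = x :=
  dif_neg (by push Not; exact h)

theorem glue_end_true (A : ArmSystem S X N J) {g : Bool → Arm H U} (hg : g ∈ J) :
    glue N J (tip N (g true) (g true).len) = tip N (g true) (g true).len := by
  refine glue_of_forall fun g' hg' h => ?_
  have := (A.tip_inj hg hg' (by have := A.le_len g hg true; lia) h).2.1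
  simp at this

theorem glue_end_eq (A : ArmSystem S X N J) {g : Bool → Arm H U} (hg : g ∈ J) (σ : Bool) :
    glue N J (tip N (g σ) (g σ).len) = tip N (g true) (g true).len := by
  cases σ
  · exact A.glue_end hg
  · exact A.glue_end_true hg

theorem glue_eq (A : ArmSystem S X N J) {x y : U} (h : glue N J x = glue N J y) :
    x = y ∨ ∃ g ∈ J, ∃ σ, x = tip N (g σ) (g σ).len ∧ y = tip N (g !σ) (g !σ).len := by
  by_cases hx : ∃ g ∈ J, x = tip N (g false) (g false).len
  · obtain ⟨g, hg, rfl⟩ := hx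
    rw [A.glue_end hg] at h
    by_cases hy : ∃ g ∈ J, y = tip N (g false) (g false).len
    · obtain ⟨g', hg', rfl⟩ := hy
      rw [A.glue_end hg'] at h
      obtain ⟨rfl, -⟩ := A.tip_inj hg hg' (by have := A.le_len g hg true; lia) h
      exact Or.inl rfl
    · push Not at hy
      rw [glue_of_forall hy] at h
      exact Or.inr ⟨g, hg, false, rfl, h.symm⟩
  · push Not at hx
    rw [glue_of_forall hx] at h
    by_cases hy : ∃ g ∈ J, y = tip N (g false) (g false).len
    · obtain ⟨g', hg', rfl⟩ := hy
      rw [A.glue_end hg'] at h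
      exact Or.inr ⟨g', hg', true, h, rfl⟩
    · push Not at hy
      rw [glue_of_forall hy] at h
      exact Or.inl h

theorem exists_glue_eq (A : ArmSystem S X N J) {p : U} (hp : p ∈ X) (l : List (Σ i, H i)) :
    ∃ p' ∈ X, ∃ l', glue N J (N p l) = N p' l' ∧ (l = [] → l' = [] ∧ p' = p) ∧ (l' = [] → l = []) := by
  by_cases hx : ∃ g ∈ J, N p l = tip N (g false) (g false).len
  · obtain ⟨g, hg, h⟩ := hx
    have h1 := A.inj _ hp _ (A.base_mem g hg false) _ _ h
    refine ⟨(g true).base, A.base_mem g hg true, (g true).pre (g true).len, ?_, ?_, ?_⟩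
    · rw [h, A.glue_end hg]; rfl
    · rintro rfl
      have := congrArg List.length h1.2
      have := A.le_len g hg false
      simp at *; lia
    · intro h'
      have := congrArg List.length h'
      have := A.le_len g hg true
      simp at *; lia
  · push Not at hx
    exact ⟨p, hp, l, glue_of_forall hx, fun h => ⟨h, rfl⟩, id⟩

theorem glue_of_mem (A : ArmSystem S X N J) {p : U} (hp : p ∈ X) : glue N J p = p := by
  obtain ⟨p', hp', l', h1, h2, h3⟩ := A.exists_glue_eq hp []
  obtain ⟨rfl, rfl⟩ := h2 rfl
  rwa [A.nil] at h1

theorem eq_nil_of_glue_mem (A : ArmSystem S X N J) {p : U} (hp : p ∈ X) {l : List (Σ i, H i)}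
    (h : glue N J (N p l) ∈ X) : l = [] := by
  obtain ⟨p', hp', l', h1, h2, h3⟩ := A.exists_glue_eq hp l
  rw [h1] at h
  exact h3 (A.inj _ hp' _ h l' [] (A.nil _).symm).2

theorem rawChart_one (p : U) (l : List (Σ i, H i)) (i : I) : rawChart N p l i 1 = N p l :=
  if_pos rfl

theorem rawChart_of_ne {p : U} {l : List (Σ i, H i)} {i : I} {y : H i} (hy : y ≠ 1) :
    rawChart N p l i y = N p (⟨i, y⟩ :: l) :=
  if_neg hy

theorem head_ne (A : ArmSystem S X N J) {p : U} {m : Σ i, H i} {l : List (Σ i, H i)} {i : I}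
    (h : IsPlace S X J p (m :: l) i) : m.1 ≠ i := by
  obtain ⟨-, ⟨h, -⟩ | ⟨g, hg, σ, k, hk, -, hl, rfl⟩⟩ := h
  · simp at h
  · cases k with
    | zero => simp at hl
    | succ k =>
      rw [Arm.pre_succ, List.cons.injEq] at hl
      rw [hl.1]
      exact A.alternating g hg σ k

/-- A place on an arm after the beginning of the arm. -/
theorem place_of_pre (A : ArmSystem S X N J) {g : Bool → Arm H U} (hg : g ∈ J) {σ : Bool} {k : ℕ}
    (hk : 12 ≤ k) {i : I} (h : IsPlace S X J (g σ).base ((g σ).pre k) i) :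
    k < (g σ).len ∧ i = ((g σ).word k).1 := by
  obtain ⟨-, ⟨h, -⟩ | ⟨g', hg', σ', k', hk', hb, hl, rfl⟩⟩ := h
  · have := congrArg List.length h
    simp at this; lia
  · obtain ⟨rfl, rfl, rfl⟩ := A.eq_of_pre_eq hg hg' hk hb hl
    exact ⟨hk', rfl⟩

theorem not_covers_of_place (A : ArmSystem S X N J) {p : U} {i : I} (h : IsPlace S X J p [] i) :
    ¬ Covers S i p := by
  obtain ⟨-, ⟨-, h⟩ | ⟨g, hg, σ, k, hk, rfl, hl, rfl⟩⟩ := h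
  · exact h
  · obtain rfl : k = 0 := by simpa using (congrArg List.length hl).symm
    exact A.free g hg σ

/-- Which points of new charts are on arms. -/
theorem rawChart_eq_tip (A : ArmSystem S X N J) {p : U} {l : List (Σ i, H i)} {i : I} {y : H i}
    (hp : IsPlace S X J p l i) {g : Bool → Arm H U} (hg : g ∈ J) {σ : Bool} {k : ℕ} (hk : 13 ≤ k)
    (h : rawChart N p l i y = tip N (g σ) k) :
    p = (g σ).base ∧ ((y = 1 ∧ l = (g σ).pre k ∧ k < (g σ).len ∧ i = ((g σ).word k).1) ∨
      (y ≠ 1 ∧ l = (g σ).pre (k - 1) ∧ ⟨i, y⟩ = (g σ).word (k - 1))) := by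
  by_cases hy : y = 1
  · subst hy
    rw [rawChart_one] at h
    obtain ⟨rfl, rfl⟩ := A.inj _ hp.1 _ (A.base_mem g hg σ) _ _ h
    obtain ⟨h1, h2⟩ := A.place_of_pre hg (by lia) hp
    exact ⟨rfl, Or.inl ⟨rfl, rfl, h1, h2⟩⟩
  · rw [rawChart_of_ne hy] at h
    obtain ⟨k, rfl⟩ : ∃ j, k = j + 1 := ⟨k - 1, by lia⟩
    obtain ⟨rfl, h2⟩ := A.inj _ hp.1 _ (A.base_mem g hg σ) _ _ h
    rw [Arm.pre_succ, List.cons.injEq] at h2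
    exact ⟨rfl, Or.inr ⟨hy, h2.2, h2.1⟩⟩

theorem rawChart_eq_end (A : ArmSystem S X N J) {p : U} {l : List (Σ i, H i)} {i : I} {y : H i}
    (hp : IsPlace S X J p l i) {g : Bool → Arm H U} (hg : g ∈ J) {σ : Bool}
    (h : rawChart N p l i y = tip N (g σ) (g σ).len) :
    p = (g σ).base ∧ y ≠ 1 ∧ l = (g σ).pre ((g σ).len - 1) ∧
      ⟨i, y⟩ = (g σ).word ((g σ).len - 1) := by
  obtain ⟨h1, h2 | h2⟩ := A.rawChart_eq_tip hp hg (by have := A.le_len g hg σ; lia) h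
  · exact absurd h2.2.2.1 (lt_irrefl _)
  · exact ⟨h1, h2⟩

theorem rawChart_injective (A : ArmSystem S X N J) {p : U} (hp : p ∈ X) (l : List (Σ i, H i))
    (i : I) : Injective (rawChart N p l i) := by
  intro y y' h
  by_cases hy : y = 1 <;> by_cases hy' : y' = 1
  · rw [hy, hy']
  · subst hy
    rw [rawChart_one, rawChart_of_ne hy'] at h
    have := congrArg List.length (A.inj _ hp _ hp _ _ h).2
    simp at this
  · subst hy'
    rw [rawChart_one, rawChart_of_ne hy] at h
    have := congrArg List.length (A.inj _ hp _ hp _ _ h).2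
    simp at this
  · rw [rawChart_of_ne hy, rawChart_of_ne hy'] at h
    have := (A.inj _ hp _ hp _ _ h).2
    simpa using this

theorem exists_rawChart_eq (p : U) (l : List (Σ i, H i)) (i : I) (y : H i) :
    ∃ l', rawChart N p l i y = N p l' ∧ (l' = [] → y = 1 ∧ l = []) := by
  by_cases hy : y = 1
  · subst hy
    exact ⟨l, rawChart_one p l i, fun h => ⟨rfl, h⟩⟩
  · exact ⟨_, rawChart_of_ne hy, by simp⟩

theorem place_eq (A : ArmSystem S X N J) {p p' : U} {l l' : List (Σ i, H i)} {i : I} {y y' : H i}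
    (hp : IsPlace S X J p l i) (hp' : IsPlace S X J p' l' i)
    (h : rawChart N p l i y = rawChart N p' l' i y') : p = p' ∧ l = l' := by
  by_cases hy : y = 1 <;> by_cases hy' : y' = 1
  · subst hy hy'
    rw [rawChart_one, rawChart_one] at h
    exact A.inj _ hp.1 _ hp'.1 _ _ h
  · subst hy
    rw [rawChart_one, rawChart_of_ne hy'] at h
    obtain ⟨rfl, rfl⟩ := A.inj _ hp.1 _ hp'.1 _ _ h
    exact absurd rfl (A.head_ne hp)
  · subst hy'
    rw [rawChart_one, rawChart_of_ne hy] at h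
    obtain ⟨rfl, rfl⟩ := A.inj _ hp.1 _ hp'.1 _ _ h
    exact absurd rfl (A.head_ne hp')
  · rw [rawChart_of_ne hy, rawChart_of_ne hy'] at h
    obtain ⟨h1, h2⟩ := A.inj _ hp.1 _ hp'.1 _ _ h
    exact ⟨h1, (List.cons_eq_cons.1 h2).2⟩

theorem not_ends (A : ArmSystem S X N J) {p p' : U} {l l' : List (Σ i, H i)} {i : I} {y y' : H i}
    (hp : IsPlace S X J p l i) (hp' : IsPlace S X J p' l' i) {g : Bool → Arm H U} (hg : g ∈ J)
    {σ : Bool} (h : rawChart N p l i y = tip N (g σ) (g σ).len)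
    (h' : rawChart N p' l' i y' = tip N (g !σ) (g !σ).len) : False := by
  have h1 := congrArg Sigma.fst (A.rawChart_eq_end hp hg h).2.2.2
  have h2 := congrArg Sigma.fst (A.rawChart_eq_end hp' hg h').2.2.2
  have h3 := A.ends g hg
  cases σ <;> simp_all

theorem covers_mem_of_old (A : ArmSystem S X N J) {p : U} {l : List (Σ i, H i)} {i j : I} {y : H i}
    (hp : IsPlace S X J p l i) (h : Covers S j (glue N J (rawChart N p l i y))) :
    y = 1 ∧ l = [] := by
  obtain ⟨l', h1, h2⟩ := exists_rawChart_eq (N := N) p l i y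
  have := A.covers_mem _ _ h
  rw [h1] at this
  exact h2 (A.eq_nil_of_glue_mem hp.1 this)

theorem old_new (A : ArmSystem S X N J) {p : U} {l : List (Σ i, H i)} {i : I} {y : H i}
    (hp : IsPlace S X J p l i) : ¬ Covers S i (glue N J (rawChart N p l i y)) := by
  intro h
  obtain ⟨rfl, rfl⟩ := A.covers_mem_of_old hp h
  rw [rawChart_one, A.nil, A.glue_of_mem hp.1] at h
  exact A.not_covers_of_place hp h

theorem extend_isAtlas (A : ArmSystem S X N J) : IsAtlas (extend S X N J) where
  inj := by
    intro i e h
    obtain h | ⟨p, l, hp, rfl⟩ := mem_extend.1 h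
    · exact A.isAtlas.inj i e h
    · intro y y' h
      obtain h | ⟨g, hg, σ, h1, h2⟩ := A.glue_eq h
      · exact A.rawChart_injective hp.1 l i h
      · exact (A.not_ends hp hp hg h1 h2).elim
  disj := by
    intro i e e' h h' y y' hy
    obtain h | ⟨p, l, hp, rfl⟩ := mem_extend.1 h <;>
      obtain h' | ⟨p', l', hp', rfl⟩ := mem_extend.1 h'
    · exact A.isAtlas.disj i e e' h h' y y' hy
    · exact (A.old_new hp' ⟨e, h, y, hy⟩).elim
    · exact (A.old_new hp ⟨e', h', y', hy.symm⟩).elim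
    · obtain h | ⟨g, hg, σ, h1, h2⟩ := A.glue_eq hy
      · obtain ⟨rfl, rfl⟩ := A.place_eq hp hp' h
        rfl
      · exact (A.not_ends hp hp' hg h1 h2).elim

theorem extend_covers (A : ArmSystem S X N J) {p : U} (hp : p ∈ X) (i : I) :
    Covers (extend S X N J) i p := by
  by_cases h : Covers S i p
  · exact h.mono subset_extend
  · refine ⟨_, mem_extend.2 (Or.inr ⟨p, [], ⟨hp, Or.inl ⟨rfl, h⟩⟩, rfl⟩), 1, ?_⟩
    rw [rawChart_one, A.nil, A.glue_of_mem hp]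

theorem exists_eq_of_extend_covers (A : ArmSystem S X N J) {q : U} {i : I}
    (h : Covers (extend S X N J) i q) : ∃ p ∈ X, ∃ l, q = N p l := by
  obtain ⟨e, he, y, rfl⟩ := h
  obtain h | ⟨p, l, hp, rfl⟩ := mem_extend.1 he
  · exact ⟨e y, A.covers_mem i _ ⟨e, h, y, rfl⟩, [], (A.nil _).symm⟩
  · obtain ⟨l', h1, -⟩ := exists_rawChart_eq (N := N) p l i y
    obtain ⟨p', hp', l'', h2, -⟩ := A.exists_glue_eq hp.1 l'
    exact ⟨p', hp', l'', by simpa [h1] using h2⟩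

theorem isPlace_pre (A : ArmSystem S X N J) {g : Bool → Arm H U} (hg : g ∈ J) {σ : Bool} {k : ℕ}
    (hk : k < (g σ).len) : IsPlace S X J (g σ).base ((g σ).pre k) ((g σ).word k).1 :=
  ⟨A.base_mem g hg σ, Or.inr ⟨g, hg, σ, k, hk, rfl, rfl, rfl⟩⟩

theorem rawChart_word (A : ArmSystem S X N J) {g : Bool → Arm H U} (hg : g ∈ J) (σ : Bool)
    (k : ℕ) : rawChart N (g σ).base ((g σ).pre k) ((g σ).word k).1 ((g σ).word k).2 =
      tip N (g σ) (k + 1) :=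
  rawChart_of_ne (A.ne_one g hg σ k)

theorem step_tip (A : ArmSystem S X N J) {g : Bool → Arm H U} (hg : g ∈ J) {σ : Bool} {k : ℕ}
    (hk : k < (g σ).len) :
    Step (extend S X N J) ((g σ).word k) (glue N J (tip N (g σ) k))
      (glue N J (tip N (g σ) (k + 1))) := by
  refine ⟨_, mem_extend.2 (Or.inr ⟨_, _, A.isPlace_pre hg hk, rfl⟩), 1, ?_, ?_⟩
  · simp only [rawChart_one]
    rfl
  · simp only [mul_one, A.rawChart_word hg]

/-- A point with nonempty list in a chart of the enlarged atlas is in a new chart. -/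
theorem exists_place (A : ArmSystem S X N J) {x : U} {j : I} (h : Covers (extend S X N J) j x)
    (hx : x ∉ X) : ∃ p l y, IsPlace S X J p l j ∧ x = glue N J (rawChart N p l j y) := by
  obtain ⟨e, he, y, rfl⟩ := h
  obtain h | ⟨p, l, hp, rfl⟩ := mem_extend.1 he
  · exact absurd (A.covers_mem _ _ ⟨e, h, y, rfl⟩) hx
  · exact ⟨p, l, y, hp, rfl⟩

theorem glue_tip_notMem (A : ArmSystem S X N J) {g : Bool → Arm H U} (hg : g ∈ J) {σ : Bool} {k : ℕ}
    (hk : k ≠ 0) : glue N J (tip N (g σ) k) ∉ X := by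
  intro h
  have := congrArg List.length (A.eq_nil_of_glue_mem (A.base_mem g hg σ) h)
  simp at this
  exact hk this

theorem glue_rawChart_notMem (A : ArmSystem S X N J) {p : U} (hp : p ∈ X) {l : List (Σ i, H i)}
    {i : I} {u : H i} (hu : u ≠ 1) : glue N J (rawChart N p l i u) ∉ X := by
  intro h
  rw [rawChart_of_ne hu] at h
  simpa using A.eq_nil_of_glue_mem hp h

/-- The types of the charts at a point far out on an arm. -/
theorem covers_tip (A : ArmSystem S X N J) {g : Bool → Arm H U} (hg : g ∈ J) {σ : Bool} {k : ℕ}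
    (hk : 13 ≤ k) {i : I} (h : Covers (extend S X N J) i (glue N J (tip N (g σ) k))) :
    i = ((g σ).word (k - 1)).1 ∨ (k < (g σ).len ∧ i = ((g σ).word k).1) ∨
      (k = (g σ).len ∧ i = ((g !σ).word ((g !σ).len - 1)).1) := by
  obtain ⟨p, l, y, hp, hx⟩ := A.exists_place h (A.glue_tip_notMem hg (by lia))
  obtain h | ⟨g', hg', σ', h1, h2⟩ := A.glue_eq hx
  · obtain ⟨-, ⟨-, -, h1, h2⟩ | ⟨-, -, h2⟩⟩ := A.rawChart_eq_tip hp hg hk h.symm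
    · exact Or.inr (Or.inl ⟨h1, h2⟩)
    · exact Or.inl (congrArg Sigma.fst h2)
  · obtain ⟨rfl, rfl, rfl⟩ := A.tip_inj hg hg' (by lia) h1
    exact Or.inr (Or.inr ⟨rfl, congrArg Sigma.fst (A.rawChart_eq_end hp hg h2).2.2.2⟩)

theorem place_or_end (A : ArmSystem S X N J) {p : U} {l : List (Σ i, H i)} {i j : I} {u : H i}
    (hp : IsPlace S X J p l i) (hu : u ≠ 1) (hne : j ≠ i)
    (hj : Covers (extend S X N J) j (glue N J (rawChart N p l i u))) :
    IsPlace S X J p (⟨i, u⟩ :: l) j ∨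
      ∃ g ∈ J, ∃ σ, rawChart N p l i u = tip N (g σ) (g σ).len := by
  obtain ⟨p', l', y', hp', hx⟩ := A.exists_place hj (A.glue_rawChart_notMem hp.1 hu)
  obtain h | ⟨g', hg', σ', h1, -⟩ := A.glue_eq hx
  · left
    by_cases hy' : y' = 1
    · subst hy'
      rw [rawChart_one, rawChart_of_ne hu] at h
      obtain ⟨rfl, rfl⟩ := A.inj _ hp.1 _ hp'.1 _ _ h
      exact hp'
    · rw [rawChart_of_ne hy', rawChart_of_ne hu] at h
      have := (A.inj _ hp.1 _ hp'.1 _ _ h).2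
      rw [List.cons.injEq] at this
      exact absurd (congrArg Sigma.fst this.1).symm hne
  · refine Or.inr ⟨g', hg', σ', ?_⟩
    exact h1

/-- A path can leave an arm only at its branching points. -/
theorem exit_tip (A : ArmSystem S X N J) {g : Bool → Arm H U} (hg : g ∈ J) {σ : Bool} {k : ℕ}
    (hk : 12 ≤ k) (hk' : k < (g σ).len) {x : U}
    (h : SameChart (extend S X N J) ((g σ).word k).1 (glue N J (tip N (g σ) k)) x) {j : I}
    (hj : Covers (extend S X N J) j x) (hne : j ≠ ((g σ).word k).1) :
    x = glue N J (tip N (g σ) k) ∨ x = glue N J (tip N (g σ) (k + 1)) := by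
  obtain ⟨e, he, ⟨y, hy⟩, u, rfl⟩ := h
  have hpl := A.isPlace_pre hg hk'
  obtain rfl := A.extend_isAtlas.disj _ _ _ he (mem_extend.2 (Or.inr ⟨_, _, hpl, rfl⟩)) y 1
    (by rw [hy, rawChart_one]; rfl)
  by_cases hu : u = 1
  · left
    simp only [hu, rawChart_one]
    rfl
  right
  suffices hs : ∀ g' ∈ J, ∀ σ' k', 13 ≤ k' →
      rawChart N (g σ).base ((g σ).pre k) ((g σ).word k).1 u = tip N (g' σ') k' →
      rawChart N (g σ).base ((g σ).pre k) ((g σ).word k).1 u = tip N (g σ) (k + 1) by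
    refine congrArg _ ?_
    obtain ⟨-, ⟨h, -⟩ | ⟨g', hg', σ', k', hk', hb, hl, -⟩⟩ | ⟨g', hg', σ', h⟩ :=
      A.place_or_end hpl hu hne hj
    · simp at h
    · have := congrArg List.length hl
      simp only [List.length_cons, Arm.length_pre] at this
      refine hs g' hg' σ' k' (by lia) ?_
      rw [rawChart_of_ne hu, tip, ← hb, ← hl]
    · exact hs g' hg' σ' _ (by have := A.le_len g' hg' σ'; lia) h
  intro g' hg' σ' k' hk13 h
  obtain ⟨hb, ⟨rfl, -⟩ | ⟨-, hl, hw⟩⟩ := A.rawChart_eq_tip hpl hg' hk13 h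
  · exact absurd rfl hu
  · obtain ⟨rfl, rfl, rfl⟩ := A.eq_of_pre_eq hg hg' hk hb hl
    rw [rawChart_of_ne hu, hw]
    rfl

/-- A path moving away from the old part of the atlas is on an arm after at most `30` steps. -/
theorem exists_tip (A : ArmSystem S X N J) {w : ℕ → Σ i, H i}
    (hw : ∀ j, (w j).2 ≠ 1) (hw' : ∀ j, (w j).1 ≠ (w (j + 1)).1) {P : ℕ → U} (d : ℕ) :
    ∀ a p l i u, IsPlace S X J p l i → u ≠ 1 → P a = glue N J (rawChart N p l i u) →
      (w a).1 ≠ i → (∀ j, a ≤ j → j ≤ a + d → Step (extend S X N J) (w j) (P j) (P (j + 1))) →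
      30 ≤ l.length + 1 + d → ∃ j, a ≤ j ∧ j ≤ a + d ∧ ∃ g ∈ J, ∃ σ k, 30 ≤ k ∧ k ≤ (g σ).len ∧
        P j = glue N J (tip N (g σ) k) := by
  induction d with
  | zero =>
    intro a p l i u hp hu hP hi hst hd
    have hc := (hst a le_rfl le_rfl).covers_left
    refine ⟨a, le_rfl, le_rfl, ?_⟩
    rw [hP] at hc
    obtain ⟨-, ⟨h, -⟩ | ⟨g, hg, σ, k, hk, hb, hl, -⟩⟩ | ⟨g, hg, σ, h⟩ :=
      A.place_or_end hp hu hi hc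
    · simp at h
    · have := congrArg List.length hl
      simp only [List.length_cons, Arm.length_pre] at this
      refine ⟨g, hg, σ, k, by lia, hk.le, ?_⟩
      rw [hP, rawChart_of_ne hu, tip, ← hb, ← hl]
    · exact ⟨g, hg, σ, _, by have := A.le_len g hg σ; lia, le_rfl, by rw [hP, h]⟩
  | succ d ih =>
    intro a p l i u hp hu hP hi hst hd
    have hc := (hst a le_rfl (by lia)).covers_left
    rw [hP] at hc
    obtain h | ⟨g, hg, σ, h⟩ := A.place_or_end hp hu hi hc
    · have hP' : P (a + 1) = glue N J (rawChart N p (⟨i, u⟩ :: l) (w a).1 (w a).2) := by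
        refine (hst a le_rfl (by lia)).right_unique A.extend_isAtlas
          ⟨_, mem_extend.2 (Or.inr ⟨_, _, h, rfl⟩), 1, ?_, ?_⟩
        · simp only [rawChart_one]
          rw [hP, rawChart_of_ne hu]
        · simp only [mul_one]
      obtain ⟨j, h1, h2, h3⟩ := ih (a + 1) p (⟨i, u⟩ :: l) (w a).1 (w a).2 h (hw a) hP'
        (hw' a).symm (fun j h1 h2 => hst j (by lia) (by lia)) (by simp only [List.length_cons]; lia)
      exact ⟨j, by lia, by lia, h3⟩
    · exact ⟨a, le_rfl, by lia, g, hg, σ, _, by have := A.le_len g hg σ; lia, le_rfl, by rw [hP, h]⟩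

end ArmSystem

/-- The closed path through the two arms of a pair. -/
noncomputable def ring (N : U → List (Σ i, H i) → U) (J : Set (Bool → Arm H U))
    (g : Bool → Arm H U) (j : ℕ) : U :=
  if j ≤ (g false).len then glue N J (tip N (g false) j)
  else glue N J (tip N (g true) ((g false).len + (g true).len - j))

/-- The word along `ring`. -/
def ringWord (g : Bool → Arm H U) (j : ℕ) : Σ i, H i :=
  if j < (g false).len then (g false).word j
  else linv ((g true).word ((g false).len + (g true).len - 1 - j))

namespace ArmSystem

variable {S : Set (Σ i, H i → U)} {X : Set U} {N : U → List (Σ i, H i) → U}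
  {J : Set (Bool → Arm H U)}

theorem ring_left (A : ArmSystem S X N J) {g : Bool → Arm H U} (hg : g ∈ J) {k : ℕ}
    (hk : k ≤ (g true).len) :
    ring N J g ((g false).len + (g true).len - k) = glue N J (tip N (g true) k) := by
  rcases hk.lt_or_eq with hk | rfl
  · rw [ring, if_neg (by lia)]
    congr 2
    lia
  · rw [Nat.add_sub_cancel, ring, if_pos le_rfl, A.glue_end_eq hg, A.glue_end_eq hg]

theorem ring_right {g : Bool → Arm H U} {k : ℕ} (hk : k ≤ (g false).len) :
    ring N J g k = glue N J (tip N (g false) k) :=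
  if_pos hk

theorem ringWord_left {g : Bool → Arm H U} {k : ℕ} (hk : k < (g true).len) :
    ringWord g ((g false).len + (g true).len - 1 - k) = linv ((g true).word k) := by
  rw [ringWord, if_neg (by lia)]
  congr 2
  lia

theorem ringWord_right {g : Bool → Arm H U} {k : ℕ} (hk : k < (g false).len) :
    ringWord g k = (g false).word k :=
  if_pos hk

theorem step_ring (A : ArmSystem S X N J) {g : Bool → Arm H U} (hg : g ∈ J) {j : ℕ}
    (hj : j < (g false).len + (g true).len) :
    Step (extend S X N J) (ringWord g j) (ring N J g j) (ring N J g (j + 1)) := by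
  by_cases h : j < (g false).len
  · rw [ringWord_right h, ring_right h.le, ring_right h]
    exact A.step_tip hg h
  · obtain ⟨k, rfl, hk⟩ : ∃ k, j = (g false).len + (g true).len - 1 - k ∧ k < (g true).len :=
      ⟨(g false).len + (g true).len - 1 - j, by lia, by lia⟩
    rw [ringWord_left hk]
    have e1 : (g false).len + (g true).len - 1 - k = (g false).len + (g true).len - (k + 1) := by
      lia
    have e2 : (g false).len + (g true).len - 1 - k + 1 = (g false).len + (g true).len - k := by
      lia
    rw [e2, e1, A.ring_left hg hk, A.ring_left hg hk.le]
    exact (A.step_tip hg hk).inv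

theorem covers_ring (A : ArmSystem S X N J) {g : Bool → Arm H U} (hg : g ∈ J) {j : ℕ}
    (hj : 13 ≤ j) (hj' : j + 13 ≤ (g false).len + (g true).len) {i : I}
    (h : Covers (extend S X N J) i (ring N J g j)) :
    i = (ringWord g j).1 ∨ i = (ringWord g (j - 1)).1 := by
  have hlen := A.le_len g hg true
  have hlen' := A.le_len g hg false
  rcases le_or_gt j (g false).len with hm | hm
  · rw [ring_right hm] at h
    obtain h | ⟨h1, h⟩ | ⟨h1, h⟩ := A.covers_tip hg hj h
    · right
      rw [h, ringWord_right (by lia)]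
    · left
      rw [h, ringWord_right h1]
    · left
      have := ringWord_left (g := g) (k := (g true).len - 1) (by lia)
      have e : (g false).len + (g true).len - 1 - ((g true).len - 1) = j := by lia
      rw [e] at this
      rw [h, this]
      rfl
  · obtain ⟨k, rfl, hk⟩ : ∃ k, j = (g false).len + (g true).len - k ∧ k < (g true).len :=
      ⟨(g false).len + (g true).len - j, by lia, by lia⟩
    rw [A.ring_left hg hk.le] at h
    obtain h | ⟨h1, h⟩ | ⟨h1, h⟩ := A.covers_tip hg (by lia) h
    · left
      have := ringWord_left (g := g) (k := k - 1) (by lia)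
      have e : (g false).len + (g true).len - 1 - (k - 1) = (g false).len + (g true).len - k := by
        lia
      rw [← e, this, h]
      rfl
    · right
      have := ringWord_left (g := g) (k := k) (by lia)
      have e : (g false).len + (g true).len - 1 - k = (g false).len + (g true).len - k - 1 := by
        lia
      rw [← e, this, h]
      rfl
    · lia

theorem exit_ring (A : ArmSystem S X N J) {g : Bool → Arm H U} (hg : g ∈ J) {j : ℕ}
    (hj : 12 ≤ j) (hj' : j + 13 ≤ (g false).len + (g true).len) {x : U}
    (h : SameChart (extend S X N J) (ringWord g j).1 (ring N J g j) x) {i : I}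
    (hi : Covers (extend S X N J) i x) (hne : i ≠ (ringWord g j).1) :
    x = ring N J g j ∨ x = ring N J g (j + 1) := by
  by_cases hm : j < (g false).len
  · rw [ringWord_right hm] at h hne
    rw [ring_right hm.le] at h ⊢
    rw [ring_right hm]
    exact A.exit_tip hg hj hm h hi hne
  · obtain ⟨k, rfl, hk⟩ : ∃ k, j = (g false).len + (g true).len - 1 - k ∧ k < (g true).len :=
      ⟨(g false).len + (g true).len - 1 - j, by lia, by lia⟩
    rw [ringWord_left hk] at h hne
    have e1 : (g false).len + (g true).len - 1 - k = (g false).len + (g true).len - (k + 1) := by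
      lia
    have e2 : (g false).len + (g true).len - 1 - k + 1 = (g false).len + (g true).len - k := by
      lia
    rw [e2, e1, A.ring_left hg hk, A.ring_left hg hk.le]
    rw [e1, A.ring_left hg hk] at h
    exact (A.exit_tip hg (by lia) hk
      ((A.step_tip hg hk).sameChart.trans A.extend_isAtlas h) hi hne).symm

theorem next_on_ring (A : ArmSystem S X N J) {g : Bool → Arm H U} (hg : g ∈ J) {j : ℕ}
    (hj : 13 ≤ j) (hj' : j + 13 ≤ (g false).len + (g true).len) {w : Σ i, H i} {x : U}
    (h : Step (extend S X N J) w (ring N J g j) x) (hw : w.2 ≠ 1) {i : I}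
    (hi : Covers (extend S X N J) i x) (hne : i ≠ w.1) :
    (w = ringWord g j ∧ x = ring N J g (j + 1)) ∨
      (w = linv (ringWord g (j - 1)) ∧ x = ring N J g (j - 1)) := by
  have hx : x ≠ ring N J g j := by
    rintro rfl
    exact hw (h.eq_one A.extend_isAtlas)
  obtain hc | hc := A.covers_ring hg hj hj' h.covers_left
  · left
    obtain rfl | rfl := A.exit_ring hg (by lia) hj' (hc ▸ h.sameChart) hi (hc ▸ hne)
    · exact absurd rfl hx
    · exact ⟨h.letter_unique A.extend_isAtlas (A.step_ring hg (by lia)) hc, rfl⟩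
  · right
    obtain ⟨j, rfl⟩ : ∃ m, j = m + 1 := ⟨j - 1, by lia⟩
    rw [Nat.add_sub_cancel] at *
    have hst := A.step_ring hg (j := j) (by lia)
    obtain rfl | rfl := A.exit_ring hg (by lia) (by lia)
      (hst.sameChart.trans A.extend_isAtlas (hc ▸ h.sameChart)) hi (hc ▸ hne)
    · exact ⟨h.letter_unique A.extend_isAtlas hst.inv hc, rfl⟩
    · exact absurd rfl hx

/-- A path starting deep inside a ring follows the ring. -/
theorem follow_ring (A : ArmSystem S X N J) {g : Bool → Arm H U} (hg : g ∈ J) {k : ℕ}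
    (hk : 30 ≤ k) (hk' : k + 30 ≤ (g false).len + (g true).len) {w : ℕ → Σ i, H i}
    (hw : ∀ j, (w j).2 ≠ 1) (hw' : ∀ j, (w j).1 ≠ (w (j + 1)).1) {P : ℕ → U}
    (hP : P 0 = ring N J g k) (hst : ∀ j < 14, Step (extend S X N J) (w j) (P j) (P (j + 1))) :
    (∀ j < 12, w j = ringWord g (k + j)) ∨ ∀ j < 12, w j = linv (ringWord g (k - 1 - j)) := by
  have key : ∀ j < 13, ∀ m, 13 ≤ m → m + 13 ≤ (g false).len + (g true).len → P j = ring N J g m →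
      (w j = ringWord g m ∧ P (j + 1) = ring N J g (m + 1)) ∨
      (w j = linv (ringWord g (m - 1)) ∧ P (j + 1) = ring N J g (m - 1)) := by
    intro j hj m hm hm' h
    exact A.next_on_ring hg hm hm' (h ▸ hst j (by lia)) (hw j)
      (hst (j + 1) (by lia)).covers_left (hw' j).symm
  obtain ⟨h1, h2⟩ | ⟨h1, h2⟩ := key 0 (by lia) k (by lia) (by lia) hP
  · left
    have : ∀ j < 12, w j = ringWord g (k + j) ∧ P (j + 1) = ring N J g (k + j + 1) := by
      intro j
      induction j with
      | zero => exact fun _ => ⟨h1, h2⟩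
      | succ j ih =>
        intro hj
        obtain ⟨h3, h4⟩ := ih (by lia)
        obtain h | h := key (j + 1) (by lia) (k + j + 1) (by lia) (by lia) h4
        · exact h
        · rw [Nat.add_sub_cancel, ← h3] at h
          exact absurd (congrArg Sigma.fst h.1).symm (hw' j)
    exact fun j hj => (this j hj).1
  · right
    have : ∀ j < 12, w j = linv (ringWord g (k - 1 - j)) ∧ P (j + 1) = ring N J g (k - 1 - j) := by
      intro j
      induction j with
      | zero => exact fun _ => ⟨h1, h2⟩
      | succ j ih =>
        intro hj
        obtain ⟨h3, h4⟩ := ih (by lia)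
        obtain h | h := key (j + 1) (by lia) (k - 1 - j) (by lia) (by lia) h4
        · exact absurd ((congrArg Sigma.fst h3).trans (congrArg Sigma.fst h.1).symm) (hw' j)
        · rwa [Nat.sub_sub (k - 1)] at h
    exact fun j hj => (this j hj).1

end ArmSystem

namespace Segment

variable {S : Set (Σ i, H i → U)} {L : K → ℤ → Σ i, H i} {X : Set U}

/-- The arms that complete a segment to a closed path. -/
def arm (f : Segment S L X) : Bool → Arm H U
  | false => ⟨f.q f.t, fun k => L f.rel (f.t + k), (160 - (f.t - f.s)).toNat⟩
  | true => ⟨f.q f.s, fun k => linv (L f.rel (f.s - 1 - k)), 40⟩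

theorem agree (hL : IsSparse L) (hS : IsAtlas S) (f f' : Segment S L X) {z z' : ℤ}
    (hrel : f.rel = f'.rel) (hd : (200 : ℤ) ∣ z' - z) (hz : f.s ≤ z) (hz' : z ≤ f.t)
    (hw : f'.s ≤ z') (hw' : z' ≤ f'.t) (h : f.q z = f'.q z') {w : ℤ} (h1 : f.s ≤ w) (h2 : w ≤ f.t)
    (h3 : f'.s ≤ w + (z' - z)) (h4 : w + (z' - z) ≤ f'.t) : f.q w = f'.q (w + (z' - z)) := by
  have ht := f'.track.shift hL hd
  rw [← hrel] at ht
  refine IsTrack.agree hS (s := max f.s (f'.s - (z' - z))) (t := min f.t (f'.t - (z' - z)))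
    (fun w h1 h2 => f.track w (by lia) (by lia)) (fun w h1 h2 => ht w (by lia) (by lia))
    (z := z) (by lia) (by lia) (by lia) (by lia) ?_
  rw [h]
  congr 1
  ring

theorem not_longer (hL : IsSparse L) (hS : IsAtlas S) (f f' : Segment S L X) {z z' : ℤ}
    (hrel : f.rel = f'.rel) (hd : (200 : ℤ) ∣ z' - z) (hz : f.s ≤ z) (hz' : z ≤ f.t)
    (hw : f'.s ≤ z') (hw' : z' ≤ f'.t) (h : f.q z = f'.q z') :
    f.s - z ≤ f'.s - z' ∧ f'.t - z' ≤ f.t - z := by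
  have ht := f'.track.shift hL hd
  rw [← hrel] at ht
  constructor
  · by_contra! hcon
    refine f.left ?_
    have := (ht (f.s - 1) (by lia) (by lia)).covers_right
    rw [sub_add_cancel] at this
    rwa [f.agree hL hS f' hrel hd hz hz' hw hw' h le_rfl (by lia) (by lia) (by lia)]
  · by_contra! hcon
    refine f.right ?_
    have := (ht f.t (by lia) (by lia)).covers_left
    rwa [f.agree hL hS f' hrel hd hz hz' hw hw' h (by lia) le_rfl (by lia) (by lia)]

theorem arm_eq (hL : IsSparse L) (hS : IsAtlas S) (f f' : Segment S L X) {z z' : ℤ}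
    (hrel : f.rel = f'.rel) (hd : (200 : ℤ) ∣ z' - z) (hz : f.s ≤ z) (hz' : z ≤ f.t)
    (hw : f'.s ≤ z') (hw' : z' ≤ f'.t) (h : f.q z = f'.q z') : f.arm = f'.arm := by
  obtain ⟨h1, h2⟩ := f.not_longer hL hS f' hrel hd hz hz' hw hw' h
  obtain ⟨h3, h4⟩ := f'.not_longer hL hS f hrel.symm ((dvd_sub_comm).1 hd) hw hw' hz hz' h.symm
  have es : f.s + (z' - z) = f'.s := by lia
  have et : f.t + (z' - z) = f'.t := by lia
  have hs := f.agree hL hS f' hrel hd hz hz' hw hw' h (w := f.s) le_rfl f.le (by lia)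
    (by have := f'.le; lia)
  have ht := f.agree hL hS f' hrel hd hz hz' hw hw' h (w := f.t) f.le le_rfl
    (by have := f'.le; lia) (by lia)
  rw [es] at hs
  rw [et] at ht
  funext σ
  cases σ
  · simp only [arm, Arm.mk.injEq]
    refine ⟨ht, funext fun k => ?_, by lia⟩
    rw [hrel]
    exact hL.periodic_of_dvd (by lia)
  · simp only [arm, Arm.mk.injEq, and_true]
    refine ⟨hs, funext fun k => ?_⟩
    rw [hrel]
    exact congrArg linv (hL.periodic_of_dvd (by lia))

theorem armSystem (hL : IsSparse L) (hS : IsAtlas S) (hX : ∀ i p, Covers S i p → p ∈ X)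
    {N : U → List (Σ i, H i) → U} (hN : ∀ p, N p [] = p)
    (hN' : ∀ p ∈ X, ∀ p' ∈ X, ∀ l l', N p l = N p' l' → p = p' ∧ l = l') :
    ArmSystem S X N (Set.range (arm : Segment S L X → Bool → Arm H U)) where
  isAtlas := hS
  covers_mem := hX
  nil := hN
  inj := hN'
  base_mem := by
    rintro _ ⟨f, rfl⟩ (_ | _)
    · exact f.mem_t
    · exact f.mem_s
  le_len := by
    rintro _ ⟨f, rfl⟩ (_ | _)
    · have := f.lt
      simp only [arm]
      lia
    · exact le_rfl
  ne_one := by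
    rintro _ ⟨f, rfl⟩ (_ | _) k
    · exact hL.ne_one _ _
    · exact inv_ne_one.2 (hL.ne_one _ _)
  alternating := by
    rintro _ ⟨f, rfl⟩ (_ | _) k
    · have := hL.alternating f.rel (f.t + k)
      simpa [arm, add_assoc] using this
    · have := hL.alternating f.rel (f.s - 1 - (k + 1))
      have e : f.s - 1 - ((k : ℤ) + 1) + 1 = f.s - 1 - k := by ring
      rw [e] at this
      simpa [arm] using this.symm
  free := by
    rintro _ ⟨f, rfl⟩ (_ | _)
    · simpa [arm] using f.right
    · simpa [arm] using f.left
  sep := by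
    rintro _ ⟨f, rfl⟩ _ ⟨f', rfl⟩ (_ | _) (_ | _) hb hw
    · refine ⟨?_, rfl⟩
      obtain ⟨h1, h2⟩ := hL.window f.rel f'.rel f.t f'.t (fun t h1 h2 => by
        have := hw t.toNat (by lia)
        simpa [arm, Int.toNat_of_nonneg h1] using this)
      exact f.arm_eq hL hS f' h1 (dvd_sub_comm.1 h2) f.le le_rfl f'.le le_rfl hb
    · refine absurd ?_ (hL.reverse f.rel f'.rel f.t (f'.s - 1))
      intro t h1 h2
      have := hw t.toNat (by lia)
      simpa [arm, Int.toNat_of_nonneg h1] using this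
    · refine absurd ?_ (hL.reverse f'.rel f.rel f'.t (f.s - 1))
      intro t h1 h2
      have := hw t.toNat (by lia)
      simpa [arm, Int.toNat_of_nonneg h1] using this.symm
    · refine ⟨?_, rfl⟩
      obtain ⟨h1, h2⟩ := hL.window f.rel f'.rel (f.s - 12) (f'.s - 12) (fun t h1 h2 => by
        have := hw (11 - t).toNat (by lia)
        have e : ((11 - t).toNat : ℤ) = 11 - t := by lia
        simp only [arm, e] at this
        rw [linv_eq_iff, linv_linv] at this
        convert this using 2 <;> lia)
      refine f.arm_eq hL hS f' h1 (z := f.s) (z' := f'.s) ?_ le_rfl f.le le_rfl f'.le hb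
      lia
  ends := by
    rintro _ ⟨f, rfl⟩
    have := hL.alternating f.rel (f.s - 41)
    have hlt := f.lt
    have e : L f.rel (f.t + ((160 - (f.t - f.s)).toNat - 1 : ℕ)) = L f.rel (f.s - 41) :=
      hL.periodic_of_dvd ⟨1, by lia⟩
    simp only [arm, linv_fst, e]
    have e' : f.s - 1 - ((40 - 1 : ℕ) : ℤ) = f.s - 41 + 1 := by norm_num; ring
    rwa [e']

theorem ringWord_arm (hL : IsSparse L) (f : Segment S L X) {j : ℕ}
    (hj : j < (f.arm false).len + (f.arm true).len) :
    ringWord f.arm j = L f.rel (f.t + j) := by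
  have hlt := f.lt
  by_cases h : j < (f.arm false).len
  · exact if_pos h
  · rw [ringWord, if_neg h]
    simp only [arm, linv_linv] at h hj ⊢
    exact hL.periodic_of_dvd ⟨-1, by lia⟩

theorem len_add_len (f : Segment S L X) :
    (((f.arm false).len + (f.arm true).len : ℕ) : ℤ) = 200 - (f.t - f.s) := by
  have := f.lt
  simp only [arm]
  lia

theorem exists_isLoop (hL : IsSparse L) {N : U → List (Σ i, H i) → U} (f : Segment S L X)
    (A : ArmSystem S X N (Set.range (arm : Segment S L X → Bool → Arm H U))) :
    ∃ r, IsLoop (extend S X N (Set.range (arm : Segment S L X → Bool → Arm H U))) L f.rel r ∧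
      (∀ z, f.s ≤ z → z ≤ f.t → r z = f.q z) ∧
      ∀ k : ℕ, k < (f.arm false).len + (f.arm true).len → r (f.t + k) =
        ring N (Set.range (arm : Segment S L X → Bool → Arm H U)) f.arm k := by
  set J := Set.range (arm : Segment S L X → Bool → Arm H U)
  have hf : f.arm ∈ J := ⟨f, rfl⟩
  have hlen := f.len_add_len
  have hlt := f.lt
  have hle := f.le
  have hring0 : ring N J f.arm 0 = f.q f.t := by
    rw [ArmSystem.ring_right (Nat.zero_le _), tip, Arm.pre_zero, A.nil]
    exact A.glue_of_mem f.mem_t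
  have hringe : ring N J f.arm ((f.arm false).len + (f.arm true).len) = f.q f.s := by
    have := A.ring_left hf (k := 0) (Nat.zero_le _)
    rw [Nat.sub_zero] at this
    rw [this, tip, Arm.pre_zero, A.nil]
    exact A.glue_of_mem f.mem_s
  let r0 : ℤ → U := fun w => if w ≤ f.t then f.q w else ring N J f.arm (w - f.t).toNat
  have h0t : ∀ k : ℕ, r0 (f.t + k) = ring N J f.arm k := by
    intro k
    cases k with
    | zero => simp [r0, hring0]
    | succ k =>
      simp only [r0]
      rw [if_neg (by lia)]
      congr 1
      lia
  have h0 : r0 (f.s + 200) = r0 f.s := by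
    have := h0t ((f.arm false).len + (f.arm true).len)
    rw [hlen, hringe] at this
    have e : f.t + (200 - (f.t - f.s)) = f.s + 200 := by ring
    rw [e] at this
    rw [this]
    simp [r0, hle]
  have hst : ∀ w, f.s ≤ w → w < f.s + 200 →
      Step (extend S X N J) (L f.rel w) (r0 w) (r0 (w + 1)) := by
    intro w h1 h2
    by_cases hw : w < f.t
    · simp only [r0]
      rw [if_pos hw.le, if_pos (by lia)]
      exact (f.track w h1 hw).mono subset_extend
    · obtain ⟨k, rfl⟩ : ∃ k : ℕ, w = f.t + k := ⟨(w - f.t).toNat, by lia⟩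
      have := h0t (k + 1)
      push_cast at this
      rw [h0t, add_assoc, this, ← f.ringWord_arm hL (by lia)]
      exact A.step_ring hf (by lia)
  have hper : ∀ w, f.s ≤ w → w ≤ f.s + 199 → r0 (f.s + (w - f.s) % 200) = r0 w := by
    intro w h1 h2
    congr 1
    lia
  refine ⟨fun z => r0 (f.s + (z - f.s) % 200), ⟨fun z => ?_, fun z => ?_⟩, ?_, ?_⟩
  · have h1 := hst (f.s + (z - f.s) % 200) (by lia) (by lia)
    rw [hL.periodic_of_dvd (z' := z) (by lia)] at h1
    have h2 : r0 (f.s + (z + 1 - f.s) % 200) = r0 (f.s + (z - f.s) % 200 + 1) := by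
      by_cases h : (z - f.s) % 200 = 199
      · rw [h, show (z + 1 - f.s) % 200 = 0 by lia, add_zero, ← h0]
        congr 1
        ring
      · congr 1
        lia
    rw [← h2] at h1
    exact h1
  · congr 1
    lia
  · intro z h1 h2
    simp only
    rw [hper z h1 (by lia)]
    exact if_pos h2
  · intro k hk
    by_cases h : f.t + k < f.s + 200
    · simp only
      rw [hper _ (by lia) (by lia), h0t]
    · lia

end Segment

section Extend

variable {S : Set (Σ i, H i → U)} {L : K → ℤ → Σ i, H i} {X : Set U}
  {N : U → List (Σ i, H i) → U}

theorem exists_loop_of_tip (hL : IsSparse L)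
    (A : ArmSystem S X N (Set.range (Segment.arm : Segment S L X → Bool → Arm H U)))
    {κ : K} {z : ℤ} {q : ℤ → U}
    (hq : IsTrack (extend S X N (Set.range (Segment.arm : Segment S L X → Bool → Arm H U)))
      L κ z (z + 14) q) (f : Segment S L X) {σ : Bool} {k : ℕ} (hk : 30 ≤ k)
    (hk' : k ≤ (f.arm σ).len)
    (h : q z = glue N (Set.range (Segment.arm : Segment S L X → Bool → Arm H U))
      (tip N (f.arm σ) k)) :
    ∃ r, IsLoop (extend S X N (Set.range (Segment.arm : Segment S L X → Bool → Arm H U))) L κ r ∧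
      r z = q z := by
  set J := Set.range (Segment.arm : Segment S L X → Bool → Arm H U)
  have hf : f.arm ∈ J := ⟨f, rfl⟩
  have hlen := f.len_add_len
  have hlenf := A.le_len _ hf false
  have hlent := A.le_len _ hf true
  obtain ⟨m, hm, hm', hmz⟩ : ∃ m, 30 ≤ m ∧ m + 30 ≤ (f.arm false).len + (f.arm true).len ∧
      q z = ring N J f.arm m := by
    cases σ
    · exact ⟨k, hk, by lia, by rw [h, ArmSystem.ring_right hk']⟩
    · exact ⟨(f.arm false).len + (f.arm true).len - k, by lia, by lia,
        by rw [h, A.ring_left hf hk']⟩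
  have hst : ∀ j < 14, Step (extend S X N J) (L κ (z + (j : ℕ))) (q (z + (j : ℕ)))
      (q (z + ((j + 1 : ℕ) : ℤ))) := by
    intro j hj
    have := hq (z + j) (by lia) (by lia)
    rwa [add_assoc] at this
  obtain h1 | h1 := A.follow_ring hf hm hm' (w := fun j => L κ (z + j)) (P := fun j => q (z + j))
    (fun j => hL.ne_one _ _) (fun j => by
      have := hL.alternating κ (z + j)
      rwa [add_assoc] at this) (by simpa using hmz) hst
  · obtain ⟨hκ, hd⟩ := hL.window κ f.rel z (f.t + m) (fun t h2 h3 => by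
      have := h1 t.toNat (by lia)
      rw [f.ringWord_arm hL (by lia)] at this
      have e : ((m + t.toNat : ℕ) : ℤ) = m + t := by lia
      simpa [e, Int.toNat_of_nonneg h2, add_assoc] using this)
    obtain ⟨r, hr, -, hr'⟩ := f.exists_isLoop hL A
    refine ⟨r, hκ ▸ hr, ?_⟩
    rw [hr.eq_of_dvd hd, hr' m (by lia), hmz]
  · refine absurd ?_ (hL.reverse κ f.rel z (f.t + m - 1))
    intro t h2 h3
    have := h1 t.toNat (by lia)
    rw [f.ringWord_arm hL (by lia)] at this
    have e : f.t + ((m - 1 - t.toNat : ℕ) : ℤ) = f.t + m - 1 - t := by lia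
    simpa [e, Int.toNat_of_nonneg h2] using this

theorem exists_tip_of_new (hL : IsSparse L) {J : Set (Bool → Arm H U)} (A : ArmSystem S X N J)
    {κ : K} {s : ℤ} {q : ℤ → U} (hq : IsTrack (extend S X N J) L κ s (s + 100) q)
    (h : q (s + 50) ∉ X) :
    ∃ z, s ≤ z ∧ z + 14 ≤ s + 100 ∧ ∃ g ∈ J, ∃ σ k, 30 ≤ k ∧ k ≤ (g σ).len ∧
      q z = glue N J (tip N (g σ) k) := by
  obtain ⟨e, he, y, hy, hy'⟩ := hq (s + 50) (by lia) (by lia)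
  rw [add_assoc, show (50 : ℤ) + 1 = 51 by norm_num] at hy'
  obtain he' | ⟨p, l, hp, rfl⟩ := mem_extend.1 he
  · exact absurd (hy ▸ A.covers_mem _ _ ⟨e, he', y, rfl⟩) h
  by_cases h1 : y = 1
  · have h2 : (L κ (s + 50)).2 * y ≠ 1 := by
      rw [h1, mul_one]
      exact hL.ne_one _ _
    obtain ⟨j, -, hj, g, hg, σ, k, hk, hk', hz⟩ := A.exists_tip
      (w := fun j => L κ (s + 51 + j)) (P := fun j => q (s + 51 + j))
      (fun j => hL.ne_one _ _) (fun j => by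
        have := hL.alternating κ (s + 51 + j)
        rwa [add_assoc (s + 51)] at this) 29 0 p l _ _ hp h2 (by simpa using hy'.symm) (by
        have := hL.alternating κ (s + 50)
        rw [add_assoc] at this
        simpa using this.symm) (fun j _ hj => by
        have := hq (s + 51 + j) (by lia) (by lia)
        rwa [add_assoc (s + 51)] at this) (by lia)
    exact ⟨s + 51 + j, by lia, by lia, g, hg, σ, k, hk, hk', hz⟩
  · obtain ⟨j, -, hj, g, hg, σ, k, hk, hk', hz⟩ := A.exists_tip
      (w := fun j => linv (L κ (s + 49 - j))) (P := fun j => q (s + 50 - j))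
      (fun j => inv_ne_one.2 (hL.ne_one _ _)) (fun j => by
        have := hL.alternating κ (s + 49 - (j + 1))
        rw [show s + 49 - ((j : ℤ) + 1) + 1 = s + 49 - j by ring] at this
        simpa using this.symm) 29 0 p l _ _ hp h1 (by simpa using hy.symm) (by
        have := hL.alternating κ (s + 49)
        rw [add_assoc] at this
        simpa using this) (fun j _ hj => by
        have := (hq (s + 49 - j) (by lia) (by lia)).inv
        rw [show s + 49 - (j : ℤ) + 1 = s + 50 - j by ring] at this
        simpa [show s + 50 - ((j : ℤ) + 1) = s + 49 - j by ring] using this) (by lia)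
    refine ⟨s + 50 - j, by lia, by lia, g, hg, σ, k, hk, hk', ?_⟩
    exact hz

/-- One step of the construction. -/
theorem exists_extension (hL : IsSparse L) (hS : IsAtlas S) (hR : Rigid S L)
    (hX : ∀ i p, Covers S i p → p ∈ X) (hN : ∀ p, N p [] = p)
    (hN' : ∀ p ∈ X, ∀ p' ∈ X, ∀ l l', N p l = N p' l' → p = p' ∧ l = l') :
    ∃ S', S ⊆ S' ∧ IsAtlas S' ∧ Rigid S' L ∧ (∀ p ∈ X, ∀ i, Covers S' i p) ∧
      ∀ i q, Covers S' i q → ∃ p ∈ X, ∃ l, q = N p l := by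
  have A := Segment.armSystem hL hS hX hN hN'
  refine ⟨_, subset_extend, A.extend_isAtlas, ?_, fun p hp i => A.extend_covers hp i,
    fun i q h => A.exists_eq_of_extend_covers h⟩
  intro κ s q hq
  suffices h : ∃ z, s ≤ z ∧ z ≤ s + 100 ∧ ∃ r, IsLoop _ L κ r ∧ r z = q z by
    obtain ⟨z, h1, h2, r, hr, hz⟩ := h
    exact ⟨r, hr, hr.isTrack.agree A.extend_isAtlas hq h1 h2 le_rfl (by lia) hz⟩
  by_cases h : q (s + 50) ∈ X
  · refine ⟨s + 50, by lia, by lia, ?_⟩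
    obtain ⟨r, hr, hz⟩ | ⟨f, rfl, h1, h2, h3⟩ := exists_loop_or_segment hS hR hX κ (s + 50) h
    · exact ⟨r, hr.mono subset_extend, hz⟩
    · obtain ⟨r, hr, hr', -⟩ := f.exists_isLoop hL A
      exact ⟨r, hr, by rw [hr' _ h1 h2, h3]⟩
  · obtain ⟨z, h1, h2, _, ⟨f, rfl⟩, σ, k, hk, hk', hz⟩ := exists_tip_of_new hL A hq h
    refine ⟨z, h1, by lia, ?_⟩
    exact exists_loop_of_tip hL A (fun w hw hw' => hq w (by lia) (by lia)) f hk hk' hz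

end Extend

section Limit

theorem exists_total_atlas {L : K → ℤ → Σ i, H i} (hL : IsSparse L) :
    ∃ (U : Type u) (X : Set U) (S : Set (Σ i, H i → U)), X.Nonempty ∧ IsAtlas S ∧ Rigid S L ∧
      ∀ i p, Covers S i p ↔ p ∈ X := by
  classical
  let V := ℕ → List (Σ i, H i)
  let X : ℕ → Set V := fun k => {f | ∀ m, k ≤ m → f m = []}
  let N : ℕ → V → List (Σ i, H i) → V := fun k p l => update p k (l ++ p k)
  let Stage : ℕ → Type u := fun k => {S : Set (Σ i, H i → V) //
    IsAtlas S ∧ Rigid S L ∧ ∀ i p, Covers S i p → p ∈ X k}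
  have hnext : ∀ k (s : Stage k), ∃ s' : Stage (k + 1), s.1 ⊆ s'.1 ∧
      ∀ p ∈ X k, ∀ i, Covers s'.1 i p := by
    rintro k ⟨S, hS, hR, hX⟩
    obtain ⟨S', h1, h2, h3, h4, h5⟩ := exists_extension (N := N k) hL hS hR hX
      (fun p => by simp [N]) (by
        intro p hp p' hp' l l' h
        have e : p k = [] := hp k le_rfl
        have e' : p' k = [] := hp' k le_rfl
        refine ⟨funext fun m => ?_, ?_⟩
        · by_cases hm : m = k
          · rw [hm, e, e']
          · have := congrFun h m
            simpa [N, hm] using this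
        · have := congrFun h k
          simpa [N, e, e'] using this)
    refine ⟨⟨S', h2, h3, fun i q hq => ?_⟩, h1, h4⟩
    obtain ⟨p, hp, l, rfl⟩ := h5 i q hq
    intro m hm
    change update p k (l ++ p k) m = []
    rw [update_of_ne (by lia)]
    exact hp m (by lia)
  choose next hsub hcov using hnext
  let start : Stage 0 := ⟨∅, ⟨fun _ _ h => h.elim, fun _ _ _ h => h.elim⟩, by
    intro κ s q hq
    obtain ⟨e, he, -⟩ := hq s le_rfl (by lia)
    exact he.elim, by
    rintro i p ⟨e, he, -⟩
    exact he.elim⟩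
  let T : ∀ k, Stage k := fun k => Nat.rec start next k
  have hmono : Monotone fun k => (T k).1 := monotone_nat_of_le_succ fun k => hsub k (T k)
  have hle : ∀ k, (T k).1 ⊆ ⋃ k, (T k).1 := fun k => Set.subset_iUnion (fun k => (T k).1) k
  refine ⟨V, ⋃ k, X k, ⋃ k, (T k).1, ⟨fun _ => [], Set.mem_iUnion.2 ⟨0, fun _ _ => rfl⟩⟩,
    ⟨?_, ?_⟩, ?_, ?_⟩
  · intro i e he
    obtain ⟨k, hk⟩ := Set.mem_iUnion.1 he
    exact (T k).2.1.inj i e hk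
  · intro i e e' he he'
    obtain ⟨k, hk⟩ := Set.mem_iUnion.1 he
    obtain ⟨k', hk'⟩ := Set.mem_iUnion.1 he'
    exact (T (max k k')).2.1.disj i e e' (hmono (le_max_left k k') hk)
      (hmono (le_max_right k k') hk')
  · intro κ s q hq
    have hst : ∀ z, ∃ k, s ≤ z → z < s + 100 → Step (T k).1 (L κ z) (q z) (q (z + 1)) := by
      intro z
      by_cases h : s ≤ z ∧ z < s + 100
      · obtain ⟨e, he, h⟩ := hq z h.1 h.2
        obtain ⟨k, hk⟩ := Set.mem_iUnion.1 he
        exact ⟨k, fun _ _ => ⟨e, hk, h⟩⟩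
      · exact ⟨0, fun h1 h2 => absurd ⟨h1, h2⟩ h⟩
    choose k hk using hst
    obtain ⟨r, hr, hrs⟩ := (T ((Finset.Ico s (s + 100)).sup k)).2.2.1 κ s q fun z h1 h2 =>
      (hk z h1 h2).mono (hmono (Finset.le_sup (Finset.mem_Ico.2 ⟨h1, h2⟩)))
    exact ⟨r, hr.mono (hle _), hrs⟩
  · intro i p
    constructor
    · rintro ⟨e, he, h⟩
      obtain ⟨k, hk⟩ := Set.mem_iUnion.1 he
      exact Set.mem_iUnion.2 ⟨k, (T k).2.2.2 i p ⟨e, hk, h⟩⟩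
    · intro h
      obtain ⟨k, hk⟩ := Set.mem_iUnion.1 h
      exact (hcov k (T k) p hk i).mono (hle (k + 1))

/-- The product of the first `n` terms of a sequence, latest term first. -/
def revProd {G : Type*} [Monoid G] (f : ℕ → G) : ℕ → G
  | 0 => 1
  | n + 1 => f n * revProd f n

/-- Sparse relators hold in some group of permutations which contains all the given groups. -/
theorem exists_perm {L : K → ℤ → Σ i, H i} (hL : IsSparse L) :
    ∃ (Ω : Type u) (φ : ∀ i, H i →* Equiv.Perm Ω), (∀ i, Injective (φ i)) ∧
      ∀ κ, revProd (fun n : ℕ => φ (L κ n).1 (L κ n).2) 200 = 1 := by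
  obtain ⟨U, X, S, ⟨p₀, hp₀⟩, hS, hR, hX⟩ := exists_total_atlas hL
  have hact : ∀ i (x : H i) (p : X), ∃ q : X, Step S ⟨i, x⟩ p q := by
    intro i x p
    obtain ⟨q, hq⟩ := Covers.exists_step (l := ⟨i, x⟩) ((hX i p).2 p.2)
    exact ⟨⟨q, (hX i q).1 hq.covers_right⟩, hq⟩
  choose act hact using hact
  let inst : ∀ i, MulAction (H i) X := fun i =>
    { smul := act i
      one_smul := fun p => by
        obtain ⟨e, he, y, hy⟩ := (hX i p).2 p.2
        exact Subtype.ext ((hact i 1 p).right_unique hS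
          ⟨e, he, y, hy, (congrArg e (one_mul y)).trans hy⟩)
      mul_smul := fun x x' p => by
        refine Subtype.ext ((hact i (x * x') p).right_unique hS ?_)
        obtain ⟨e, he, y, h1, h2⟩ := hact i x' p
        obtain ⟨e', he', y', h3, h4⟩ := hact i x (act i x' p)
        obtain rfl := hS.disj _ _ _ he' he _ _ (h3.trans h2.symm)
        obtain rfl := hS.inj _ _ he' (h3.trans h2.symm)
        exact ⟨e', he, y, h1, (congrArg e' (mul_assoc x x' y)).trans h4⟩ }
  refine ⟨X, fun i => MulAction.toPermHom (H i) X, fun i x x' h => ?_, fun κ => ?_⟩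
  · have h1 : act i x ⟨p₀, hp₀⟩ = act i x' ⟨p₀, hp₀⟩ := congrArg (fun f => f ⟨p₀, hp₀⟩) h
    have h2 := hact i x ⟨p₀, hp₀⟩
    rw [h1] at h2
    exact eq_of_heq (Sigma.mk.inj_iff.1 (h2.letter_unique hS (hact i x' _) rfl)).2
  · set f : ℕ → Equiv.Perm X := fun n => MulAction.toPermHom (H (L κ n).1) X (L κ n).2
    ext p
    let q : ℤ → U := fun z => (revProd f z.toNat p : X)
    have hq : IsTrack S L κ 0 200 q := by
      intro z h1 h2
      obtain ⟨n, rfl⟩ := Int.eq_ofNat_of_zero_le h1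
      exact hact (L κ n).1 (L κ n).2 (revProd f n p)
    obtain ⟨r, hr, h0⟩ := hR κ 0 q fun z h1 h2 => hq z h1 (by lia)
    have h1 := hr.isTrack.agree hS hq le_rfl (by norm_num) (by norm_num) le_rfl h0
    have h2 := hr.periodic 0
    rw [zero_add, h1, h0] at h2
    exact h2

end Limit

/-- The data of a relator `δ a b₁ a b₂ a ⋯ a b₉₉ a`, read from right to left. -/
structure Relator (H : I → Type u) where
  i : I
  i' : I
  k : I
  a : H i
  δ : H k
  b : ℕ → H i'

namespace Relator

/-- The letters of a relator, repeated periodically. -/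
def letter (R : Relator H) (z : ℤ) : Σ i, H i :=
  if z % 200 = 0 then ⟨R.k, R.δ⟩
  else if z % 2 = 1 then ⟨R.i, R.a⟩ else ⟨R.i', R.b (z % 200 / 2).toNat⟩

theorem letter_zero (R : Relator H) {z : ℤ} (h : z % 200 = 0) : R.letter z = ⟨R.k, R.δ⟩ :=
  if_pos h

theorem letter_odd (R : Relator H) {z : ℤ} (h : z % 2 = 1) : R.letter z = ⟨R.i, R.a⟩ := by
  rw [letter, if_neg (by lia), if_pos h]

theorem letter_even (R : Relator H) {z : ℤ} (h : z % 2 = 0) (h' : z % 200 ≠ 0) :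
    R.letter z = ⟨R.i', R.b (z % 200 / 2).toNat⟩ := by
  rw [letter, if_neg h', if_neg (by lia)]

theorem exists_shift (z z' : ℤ) : ∃ t : ℤ, 0 ≤ t ∧ t ≤ 9 ∧ (z + t) % 2 = 0 ∧
    1 ≤ (z + t) % 200 ∧ (z + t) % 200 ≤ 197 ∧ 1 ≤ (z' + t) % 200 ∧ (z' + t) % 200 ≤ 197 := by
  obtain ⟨s, hs, hz⟩ : ∃ s : ℤ, (s = 0 ∨ s = 1) ∧ (z + s) % 2 = 0 :=
    ⟨z % 2, by lia, by lia⟩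
  by_contra! h
  have h0 := h s (by lia) (by lia) hz
  have h4 := h (s + 4) (by lia) (by lia) (by lia)
  have h8 := h (s + 8) (by lia) (by lia) (by lia)
  omega

theorem isSparse {R : K → Relator H} (hi : ∀ κ, (R κ).i ≠ (R κ).i') (hk : ∀ κ, (R κ).i ≠ (R κ).k)
    (ha : ∀ κ, (R κ).a ≠ 1) (hδ : ∀ κ, (R κ).δ ≠ 1) (hb : ∀ κ j, (R κ).b j ≠ 1)
    (hu : ∀ κ κ' j j', (⟨_, (R κ).b j⟩ : Σ i, H i) = ⟨_, (R κ').b j'⟩ → κ = κ' ∧ j = j')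
    (hu' : ∀ κ κ' j j', (⟨_, (R κ).b j⟩ : Σ i, H i) = linv ⟨_, (R κ').b j'⟩ → κ = κ' ∧ j = j') :
    IsSparse fun κ => (R κ).letter where
  periodic κ z := by
    simp only [letter, Int.add_emod_right, show (z + 200) % 2 = z % 2 by lia]
  ne_one κ z := by
    by_cases h : z % 200 = 0
    · rw [letter_zero _ h]; exact hδ κ
    · by_cases h' : z % 2 = 1
      · rw [letter_odd _ h']; exact ha κ
      · rw [letter_even _ (by lia : z % 2 = 0) h]; exact hb κ _
  alternating κ z := by
    by_cases h' : z % 2 = 1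
    · rw [letter_odd _ h']
      by_cases h : (z + 1) % 200 = 0
      · simpa only [letter_zero _ h] using hk κ
      · simpa only [letter_even _ (by lia : (z + 1) % 2 = 0) h] using hi κ
    · rw [letter_odd _ (by lia : (z + 1) % 2 = 1)]
      by_cases h : z % 200 = 0
      · simpa only [letter_zero _ h] using (hk κ).symm
      · simpa only [letter_even _ (by lia : z % 2 = 0) h] using (hi κ).symm
  window κ κ' z z' h := by
    obtain ⟨t, h0, h1, h2, h3, h4, h5, h6⟩ : ∃ t : ℤ, 0 ≤ t ∧ t ≤ 9 ∧ (z + t) % 2 = 0 ∧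
        1 ≤ (z + t) % 200 ∧ (z + t) % 200 ≤ 197 ∧ 1 ≤ (z' + t) % 200 ∧ (z' + t) % 200 ≤ 197 := by
      exact exists_shift z z'
    have e1 := h t h0 (by lia)
    have e2 := h (t + 2) (by lia) (by lia)
    rw [letter_even _ h2 (by lia)] at e1
    rw [letter_even _ (by lia) (by lia)] at e2
    by_cases h7 : (z' + t) % 2 = 0
    · rw [letter_even _ h7 (by lia)] at e1
      obtain ⟨h8, h9⟩ := hu _ _ _ _ e1
      exact ⟨h8, by lia⟩
    · rw [letter_odd _ (by lia)] at e1 e2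
      have := (hu _ _ _ _ (e1.trans e2.symm)).2
      lia
  reverse κ κ' z z' h := by
    obtain ⟨t, h0, h1, h2, h3, h4, h5, h6⟩ : ∃ t : ℤ, 0 ≤ t ∧ t ≤ 9 ∧ (z + t) % 2 = 0 ∧
        1 ≤ (z + t) % 200 ∧ (z + t) % 200 ≤ 197 ∧ 3 ≤ (z' - t) % 200 ∧ (z' - t) % 200 ≤ 199 := by
      obtain ⟨t, h0, h1, h2, h3, h4, h5, h6⟩ := exists_shift z (-z')
      exact ⟨t, h0, h1, h2, h3, h4, by lia, by lia⟩
    have e1 := h t h0 (by lia)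
    have e2 := h (t + 2) (by lia) (by lia)
    rw [letter_even _ h2 (by lia)] at e1
    rw [letter_even _ (by lia) (by lia)] at e2
    by_cases h7 : (z' - t) % 2 = 0
    · rw [letter_even _ h7 (by lia)] at e1
      rw [letter_even _ (by lia) (by lia)] at e2
      have h8 := (hu' _ _ _ _ e1).2
      have h9 := (hu' _ _ _ _ e2).2
      lia
    · rw [letter_odd _ (by lia)] at e1 e2
      have := (hu _ _ _ _ (e1.trans e2.symm)).2
      lia

end Relator

open Cardinal in
/-- An infinite group has a subset of full cardinality that avoids the identity and meets every
pair formed by an element and its inverse in at most one element. -/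
theorem exists_inv_injective {B T : Type u} [Group B] [Infinite B] (h : #T ≤ #B) :
    ∃ f : T → B, (∀ x, f x ≠ 1) ∧ (∀ x y, f x = f y → x = y) ∧ ∀ x y, f x = (f y)⁻¹ → x = y := by
  classical
  let r : Setoid B :=
    { r := fun x y => x = y ∨ x = y⁻¹
      iseqv := ⟨fun _ => .inl rfl, by rintro x y (rfl | rfl) <;> simp, by
        rintro x y z (rfl | rfl) (rfl | rfl) <;> simp⟩ }
  have hout (b : B) : (Quotient.mk r b).out = b ∨ (Quotient.mk r b).out = b⁻¹ :=
    Quotient.mk_out (s := r) b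
  let e : B → Quotient r × Bool := fun b => (Quotient.mk r b, decide ((Quotient.mk r b).out = b))
  have he : Injective e := by
    intro x y hxy
    simp only [e, Prod.mk.injEq, decide_eq_decide] at hxy
    obtain ⟨h1, h2⟩ := hxy
    have hx := hout x
    have hy := hout y
    rw [h1] at h2 hx
    by_cases h3 : (Quotient.mk r y).out = y
    · exact (h2.2 h3).symm.trans h3
    · have h4 := hx.resolve_left fun h => h3 (h2.1 h)
      exact inv_injective (h4.symm.trans (hy.resolve_left h3))
  have hQ : Infinite (Quotient r) := by
    by_contra hfin
    rw [not_infinite_iff_finite] at hfin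
    exact not_finite_iff_infinite.2 ‹Infinite B› (Finite.of_injective e he)
  have hBQ : #B ≤ #(Quotient r) := by
    refine (mk_le_of_injective he).trans ?_
    rw [mk_prod, lift_uzero]
    exact mul_le_of_le (aleph0_le_mk _) le_rfl
      ((lift_le_aleph0.2 mk_le_aleph0).trans (aleph0_le_mk _))
  have hc : #(({Quotient.mk r 1} : Set (Quotient r))ᶜ : Set (Quotient r)) = #(Quotient r) :=
    mk_compl_of_infinite _ (by simpa using (one_lt_aleph0.trans_le (aleph0_le_mk _)))
  obtain ⟨g⟩ := h.trans (hBQ.trans hc.ge)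
  have hg {x y : T} (h : Quotient.mk r (g x).1.out = Quotient.mk r (g y).1.out) : x = y := by
    rw [Quotient.out_eq, Quotient.out_eq] at h
    exact g.injective (Subtype.ext h)
  refine ⟨fun x => (g x).1.out, fun x hx => ?_, fun x y hxy => ?_, fun x y hxy => ?_⟩
  · have h1 := Quotient.out_eq (g x).1
    rw [show (g x).1.out = 1 from hx] at h1
    exact (g x).2 h1.symm
  · exact hg (congrArg _ hxy)
  · exact hg (Quotient.sound (s := r) (Or.inr hxy))

theorem revProd_succ' {G : Type*} [Monoid G] (f : ℕ → G) (n : ℕ) :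
    revProd f (n + 1) = revProd (fun m => f (m + 1)) n * f 0 := by
  induction n with
  | zero => simp [revProd]
  | succ n ih => rw [revProd, ih, revProd, mul_assoc]

theorem map_revProd {G G' : Type*} [Monoid G] [Monoid G'] (ψ : G →* G') (f : ℕ → G) (n : ℕ) :
    ψ (revProd f n) = revProd (fun m => ψ (f m)) n := by
  induction n with
  | zero => simp [revProd]
  | succ n ih => rw [revProd, map_mul, ih, revProd]

theorem revProd_mem {G : Type*} [Group G] {C : Subgroup G} {f : ℕ → G} (h : ∀ n, f n ∈ C) (n : ℕ) :
    revProd f n ∈ C := by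
  induction n with
  | zero => exact C.one_mem
  | succ n ih => exact C.mul_mem (h n) ih

/-- The product `b₉₉ ⋯ b₂ b₁` of the letters of a relator in its second factor. -/
def coreProd {B : Type*} [Monoid B] (b : ℕ → B) : B :=
  revProd (fun n => if n % 2 = 0 then 1 else b ((n + 1) / 2)) 199

theorem exists_coreProd_ne {B : Type*} [Group B] {f : ℕ → B} (hf : Injective f) (g : B) :
    ∃ σ : Equiv.Perm ℕ, coreProd (fun j => f (σ j)) ≠ g := by
  by_contra! h
  have key (σ : Equiv.Perm ℕ) : coreProd (fun j => f (σ j)) =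
      revProd (fun n => if n % 2 = 0 then 1 else f (σ ((n + 2 + 1) / 2))) 197 * f (σ 1) := by
    rw [coreProd, revProd_succ', revProd_succ']
    have h2 (n : ℕ) : (n + 1 + 1) % 2 = n % 2 := by lia
    simp [h2]
  have h1 := (h 1).trans (h (Equiv.swap 0 1)).symm
  rw [key, key] at h1
  have e : (fun n : ℕ => if n % 2 = 0 then 1 else f (Equiv.swap 0 1 ((n + 2 + 1) / 2))) =
      fun n : ℕ => if n % 2 = 0 then 1 else f ((1 : Equiv.Perm ℕ) ((n + 2 + 1) / 2)) := by
    funext n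
    rcases Nat.mod_two_eq_zero_or_one n with hn | hn
    · rw [if_pos hn, if_pos hn]
    · rw [Equiv.swap_apply_of_ne_of_ne (by lia) (by lia)]
      rfl
  rw [e] at h1
  have h2 := hf (mul_left_cancel h1)
  simp at h2

/-- The instances of the relations to be imposed: `g : H k` is to be expressed by means of
`a : H i` and of elements of the large group `H i'`. -/
@[ext]
structure Task (H : I → Type u) [∀ i, Group (H i)] (large : I → Prop) where
  i : I
  a : H i
  i' : I
  k : I
  g : H k
  a_ne : a ≠ 1
  g_ne : g ≠ 1
  i_ne_i' : i ≠ i'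
  i_ne_k : i ≠ k
  large_i' : large i'

open Cardinal in
theorem mk_task_le {lam : Cardinal.{u}} (hlam : ℵ₀ ≤ lam) (hI : #I ≤ lam) (hH : ∀ i, #(H i) ≤ lam)
    (large : I → Prop) : #(Task H large) ≤ lam := by
  have hS : #(Σ i, H i) ≤ lam := by
    rw [mk_sigma]
    refine (sum_le_sum _ _ hH).trans ?_
    rw [sum_const']
    exact mul_le_of_le hlam hI le_rfl
  let e : Task H large → (Σ i, H i) × I × (Σ i, H i) := fun τ => (⟨τ.i, τ.a⟩, τ.i', ⟨τ.k, τ.g⟩)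
  have he : Injective e := by
    intro τ τ' h
    simp only [e, Prod.mk.injEq, Sigma.mk.injEq] at h
    exact Task.ext h.1.1 h.1.2 h.2.1 h.2.2.1 h.2.2.2
  refine (mk_le_of_injective he).trans ?_
  rw [mk_prod, mk_prod]
  simp only [lift_id]
  exact mul_le_of_le hlam hS (mul_le_of_le hlam hI hS)

open Cardinal in
theorem exists_relators {lam : Cardinal.{u}} (hlam : ℵ₀ ≤ lam) (hI : #I ≤ lam)
    (hH : ∀ i, #(H i) ≤ lam) :
    ∃ (b : ∀ τ : Task H (fun i => #(H i) = lam), ℕ → H τ.i') (δ : ∀ τ, H (Task.k τ)),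
      (IsSparse fun τ => (Relator.mk τ.i τ.i' τ.k τ.a (δ τ) (b τ)).letter) ∧
      (∀ τ, τ.i' ≠ τ.k → δ τ = τ.g) ∧
      ∀ τ (h : τ.i' = τ.k), cast (congrArg H h) (coreProd (b τ)) * δ τ = τ.g := by
  have hT : #(Task H (fun i => #(H i) = lam) × ℕ) ≤ lam := by
    rw [mk_prod, lift_uzero, mk_nat, lift_aleph0]
    exact mul_le_of_le hlam (by simpa using mk_task_le hlam hI hH _) hlam
  have hf (i : I) (hi : #(H i) = lam) := by
    haveI : Infinite (H i) := infinite_iff.2 (hi ▸ hlam)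
    exact exists_inv_injective (hT.trans hi.ge)
  choose f hf1 hfi hfinv using hf
  have hδ (τ : Task H (fun i => #(H i) = lam)) : ∃ (σ : Equiv.Perm ℕ) (δ : H τ.k), δ ≠ 1 ∧
      (τ.i' ≠ τ.k → δ = τ.g) ∧ ∀ h : τ.i' = τ.k,
        cast (congrArg H h) (coreProd (fun j => f τ.i' τ.large_i' (τ, σ j))) * δ = τ.g := by
    by_cases h : τ.i' = τ.k
    · generalize hF : (fun j => f τ.i' τ.large_i' (τ, j)) = F
      have hFi : Injective F := by
        rw [← hF]
        intro x y hxy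
        simpa using hfi _ _ _ _ hxy
      have hF' (j : ℕ) : f τ.i' τ.large_i' (τ, j) = F j := congrFun hF j
      simp only [hF']
      clear hF hF'
      generalize τ.g = g at *
      revert F g
      rw [← h]
      intro F hFi g
      obtain ⟨σ, hσ⟩ := exists_coreProd_ne hFi g
      exact ⟨σ, (coreProd fun j => F (σ j))⁻¹ * g, fun h => hσ (inv_mul_eq_one.1 h),
        fun h => (h rfl).elim, fun h => mul_inv_cancel_left _ _⟩
    · exact ⟨1, τ.g, τ.g_ne, fun _ => rfl, fun h' => (h h').elim⟩
  choose σ δ hδ1 hδ2 hδ3 using hδ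
  refine ⟨fun τ j => f τ.i' τ.large_i' (τ, σ τ j), δ, ?_, hδ2, hδ3⟩
  have aux {κ κ' : Task H (fun i => #(H i) = lam)} {j j' : ℕ} (h : (κ, σ κ j) = (κ', σ κ' j')) :
      κ = κ' ∧ j = j' := by
    obtain ⟨rfl, h⟩ := Prod.mk.inj h
    exact ⟨rfl, (σ κ).injective h⟩
  have aux1 (i i' : I) (hi hi') (x y) (h : (⟨i, f i hi x⟩ : Σ i, H i) = ⟨i', f i' hi' y⟩) :
      x = y := by
    obtain rfl := congrArg Sigma.fst h
    exact hfi _ _ _ _ (eq_of_heq (Sigma.mk.inj h).2)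
  have aux2 (i i' : I) (hi hi') (x y) (h : (⟨i, f i hi x⟩ : Σ i, H i) = linv ⟨i', f i' hi' y⟩) :
      x = y := by
    obtain rfl := congrArg Sigma.fst h
    exact hfinv _ _ _ _ (eq_of_heq (Sigma.mk.inj h).2)
  exact Relator.isSparse (fun τ => τ.i_ne_i') (fun τ => τ.i_ne_k) (fun τ => τ.a_ne) hδ1
    (fun τ j => hf1 _ _ _) (fun _ _ _ _ h => aux (aux1 _ _ _ _ _ _ h))
    (fun _ _ _ _ h => aux (aux2 _ _ _ _ _ _ h))

theorem revProd_congr {G : Type*} [Monoid G] {f f' : ℕ → G} {n : ℕ} (h : ∀ m < n, f m = f' m) :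
    revProd f n = revProd f' n := by
  induction n with
  | zero => rfl
  | succ n ih => rw [revProd, revProd, h n (by lia), ih fun m hm => h m (by lia)]

theorem map_coreProd {G G' : Type*} [Monoid G] [Monoid G'] (ψ : G →* G') (b : ℕ → G) :
    ψ (coreProd b) =
      revProd (fun n => if n % 2 = 0 then 1 else ψ (b ((n + 1) / 2))) 199 := by
  rw [coreProd, map_revProd]
  simp only [apply_ite ψ, map_one]

theorem revProd_letter {G : Type*} [Group G] (φ : ∀ i, H i →* G) (R : Relator H) :
    revProd (fun n : ℕ => φ (R.letter n).1 (R.letter n).2) 200 =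
      revProd (fun n => if n % 2 = 0 then φ R.i R.a else φ R.i' (R.b ((n + 1) / 2))) 199 *
        φ R.k R.δ := by
  have h0 : φ R.k R.δ = φ (R.letter (0 : ℕ)).1 (R.letter (0 : ℕ)).2 := by
    rw [R.letter_zero (by rfl)]
  rw [h0, revProd_succ']
  refine congrArg (· * _) (revProd_congr fun n hn => ?_)
  split_ifs with h
  · rw [R.letter_odd (by lia)]
  · rw [R.letter_even (by lia) (by lia),
      show (((n + 1 : ℕ) : ℤ) % 200 / 2).toNat = (n + 1) / 2 by lia]

open Cardinal in
/-- A group containing all the groups `H i` in which any two of them, one of which is large,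
generate everything, and in which any normal subgroup meeting `H i` nontrivially contains all
the other large groups `H i'`. -/
theorem exists_group {lam : Cardinal.{u}} (hlam : ℵ₀ ≤ lam) (hI : #I ≤ lam)
    (hH : ∀ i, #(H i) ≤ lam) [∀ i, Nontrivial (H i)] :
    ∃ (P : Type u) (_ : Group P) (φ : ∀ i, H i →* P), (∀ i, Injective (φ i)) ∧
      (∀ i i', i ≠ i' → #(H i') = lam →
        Subgroup.closure (Set.range (φ i) ∪ Set.range (φ i')) = ⊤) ∧
      ∀ (M : Subgroup P), M.Normal → ∀ i i', i ≠ i' → #(H i') = lam →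
        ∀ a : H i, a ≠ 1 → φ i a ∈ M → ∀ g, φ i' g ∈ M := by
  obtain ⟨b, δ, hsparse, hδ, hcore⟩ := exists_relators (H := H) hlam hI hH
  obtain ⟨Ω, ψ, hψ, hrel⟩ := exists_perm hsparse
  let P : Subgroup (Equiv.Perm Ω) := Subgroup.closure (⋃ i, Set.range (ψ i))
  have hmem (i : I) (x : H i) : ψ i x ∈ P :=
    Subgroup.subset_closure (Set.mem_iUnion.2 ⟨i, x, rfl⟩)
  let φ (i : I) : H i →* P := (ψ i).codRestrict P (hmem i)
  have hφ (τ : Task H fun i => #(H i) = lam) :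
      revProd (fun n => if n % 2 = 0 then φ τ.i τ.a else φ τ.i' (b τ ((n + 1) / 2))) 199 *
        φ τ.k (δ τ) = 1 := by
    have h := hrel τ
    rw [← revProd_letter φ ⟨τ.i, τ.i', τ.k, τ.a, δ τ, b τ⟩]
    apply P.subtype_injective
    rw [map_revProd, map_one]
    exact h
  refine ⟨P, inferInstance, φ, fun i x y h => hψ i (congrArg Subtype.val h), ?_, ?_⟩
  · intro i i' hi hi'
    set C := Subgroup.closure (Set.range (φ i) ∪ Set.range (φ i')) with hC
    have h1 (x : H i) : φ i x ∈ C := Subgroup.subset_closure (.inl ⟨x, rfl⟩)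
    have h2 (x : H i') : φ i' x ∈ C := Subgroup.subset_closure (.inr ⟨x, rfl⟩)
    have h3 (k : I) (g : H k) : φ k g ∈ C := by
      rcases eq_or_ne i k with rfl | hik
      · exact h1 g
      rcases eq_or_ne i' k with rfl | hi'k
      · exact h2 g
      rcases eq_or_ne g 1 with rfl | hg
      · rw [map_one]; exact C.one_mem
      obtain ⟨a, ha⟩ := exists_ne (1 : H i)
      have h := hφ ⟨i, a, i', k, g, ha, hg, hi, hik, hi'⟩
      rw [hδ _ hi'k] at h
      rw [eq_inv_of_mul_eq_one_right h]
      refine C.inv_mem (revProd_mem (fun n => ?_) _)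
      split_ifs
      exacts [h1 _, h2 _]
    rw [eq_top_iff, ← Subgroup.map_subtype_le_map_subtype]
    rw [← MonoidHom.range_eq_map, Subgroup.range_subtype, Subgroup.closure_le]
    rintro _ ⟨_, ⟨k, rfl⟩, g, rfl⟩
    exact ⟨φ k g, h3 k g, rfl⟩
  · intro M hM i i' hi hi' a ha haM g
    rcases eq_or_ne g 1 with rfl | hg
    · rw [map_one]; exact M.one_mem
    let τ : Task H fun i => #(H i) = lam := ⟨i, a, i', i', g, ha, hg, hi, hi, hi'⟩
    let π := QuotientGroup.mk' M
    have h := congrArg π (hφ τ)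
    rw [map_mul, map_revProd, map_one] at h
    have h1 : (fun n => π (if n % 2 = 0 then φ τ.i τ.a else φ τ.i' (b τ ((n + 1) / 2)))) =
        fun n => if n % 2 = 0 then 1 else π.comp (φ i') (b τ ((n + 1) / 2)) := by
      funext n
      split_ifs with hn
      · exact (QuotientGroup.eq_one_iff _).2 haM
      · rfl
    rw [h1, ← map_coreProd (π.comp (φ i'))] at h
    rw [← QuotientGroup.eq_one_iff, ← show coreProd (b τ) * δ τ = g from hcore τ rfl]
    exact (map_mul (π.comp (φ i')) _ _).trans h

theorem exists_maximal_normal {P : Type*} [Group P] {x : P} (hx : x ≠ 1) :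
    ∃ N : Subgroup P, N.Normal ∧ x ∉ N ∧ ∀ M : Subgroup P, M.Normal → N ≤ M → x ∉ M → M = N := by
  obtain ⟨N, -, hN⟩ : ∃ N : Subgroup P, ⊥ ≤ N ∧ Maximal (fun N => N.Normal ∧ x ∉ N) N := by
    refine zorn_le_nonempty₀ {N : Subgroup P | N.Normal ∧ x ∉ N} (fun c hc hchain M hM => ?_) ⊥
      ⟨inferInstance, by simpa using hx⟩
    have hmem {y : P} : y ∈ sSup c ↔ ∃ N ∈ c, y ∈ N :=
      Subgroup.mem_sSup_of_directedOn ⟨M, hM⟩ hchain.directedOn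
    refine ⟨sSup c, ⟨⟨fun y hy g => ?_⟩, fun h => ?_⟩, fun N hN => le_sSup hN⟩
    · obtain ⟨N, hN, hyN⟩ := hmem.1 hy
      exact hmem.2 ⟨N, hN, (hc hN).1.conj_mem y hyN g⟩
    · obtain ⟨N, hN, hxN⟩ := hmem.1 h
      exact (hc hN).2 hxN
  exact ⟨N, hN.prop.1, hN.prop.2, fun M hM hNM hxM => (hN.eq_of_le ⟨hM, hxM⟩ hNM).symm⟩

open Cardinal in
theorem mk_le_of_closure_eq_top {G : Type u} [Group G] {s : Set G} {lam : Cardinal.{u}}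
    (hlam : ℵ₀ ≤ lam) (hs : #s ≤ lam) (h : Subgroup.closure s = ⊤) : #G ≤ lam := by
  have hsurj : Surjective (FreeGroup.lift ((↑) : s → G)) := by
    rw [← MonoidHom.range_eq_top, FreeGroup.range_lift_eq_closure, Subtype.range_coe, h]
  refine (mk_le_of_surjective hsurj).trans ?_
  rcases isEmpty_or_nonempty s with hs' | hs'
  · exact mk_le_aleph0.trans hlam
  · rw [mk_freeGroup]
    exact max_le hs hlam

open Cardinal in
theorem exists_simple_of_two_large {lam : Cardinal.{u}} (hlam : ℵ₀ ≤ lam) (hI : #I ≤ lam)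
    (hH : ∀ i, #(H i) ≤ lam) [∀ i, Nontrivial (H i)] {j₀ j₁ : I} (hj : j₀ ≠ j₁)
    (h₀ : #(H j₀) = lam) (h₁ : #(H j₁) = lam) :
    ∃ (S : Type u) (_ : Group S), IsSimpleGroup S ∧ #S = lam ∧ ∃ φ : ∀ i, H i →* S,
      (∀ i, Injective (φ i)) ∧ ∀ i i' : I, i ≠ i' → #(H i') = lam →
        Subgroup.closure (Set.range (φ i) ∪ Set.range (φ i')) = ⊤ := by
  obtain ⟨P, hP, φ, hφ, hgen, hnorm⟩ := exists_group (H := H) hlam hI hH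
  have hlarge (i : I) : ∃ j, i ≠ j ∧ #(H j) = lam := by
    rcases eq_or_ne i j₀ with rfl | h
    · exact ⟨j₁, hj, h₁⟩
    · exact ⟨j₀, h, h₀⟩
  have htop (M : Subgroup P) (hM : M.Normal) (i : I) (a : H i) (ha : a ≠ 1) (haM : φ i a ∈ M) :
      M = ⊤ := by
    obtain ⟨j, hij, hj⟩ := hlarge i
    obtain ⟨k, hjk, hk⟩ := hlarge j
    have h1 := hnorm M hM i j hij hj a ha haM
    obtain ⟨b, hb⟩ := exists_ne (1 : H j)
    have h2 := hnorm M hM j k hjk hk b hb (h1 b)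
    rw [eq_top_iff, ← hgen j k hjk hk, Subgroup.closure_le]
    rintro _ (⟨x, rfl⟩ | ⟨x, rfl⟩)
    exacts [h1 x, h2 x]
  obtain ⟨a₀, ha₀⟩ := exists_ne (1 : H j₀)
  obtain ⟨N, hN, hx, hmax⟩ := exists_maximal_normal (x := φ j₀ a₀)
    (fun h => ha₀ (hφ j₀ (h.trans (map_one _).symm)))
  let π := QuotientGroup.mk' N
  have hπ : Surjective π := QuotientGroup.mk'_surjective N
  have hinj (i : I) : Injective (π.comp (φ i)) := by
    rw [injective_iff_map_eq_one]
    intro a ha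
    by_contra ha1
    refine hx ?_
    rw [htop N hN i a ha1 ((QuotientGroup.eq_one_iff _).1 ha)]
    trivial
  have hgen' (i i' : I) (hi : i ≠ i') (hi' : #(H i') = lam) :
      Subgroup.closure (Set.range (π.comp (φ i)) ∪ Set.range (π.comp (φ i'))) = ⊤ := by
    rw [MonoidHom.coe_comp, MonoidHom.coe_comp, Set.range_comp, Set.range_comp, ← Set.image_union,
      ← MonoidHom.map_closure, hgen i i' hi hi', Subgroup.map_top_of_surjective _ hπ]
  have hnt : Nontrivial (P ⧸ N) := (hinj j₀).nontrivial
  refine ⟨P ⧸ N, inferInstance, ⟨fun M hM => ?_⟩, le_antisymm ?_ ?_, fun i => π.comp (φ i), hinj,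
    hgen'⟩
  · have hle : N ≤ M.comap π := (QuotientGroup.ker_mk' N).ge.trans (MonoidHom.ker_le_comap π M)
    by_cases hxM : φ j₀ a₀ ∈ M.comap π
    · right
      rw [← Subgroup.map_comap_eq_self_of_surjective hπ M,
        htop _ (hM.comap π) j₀ a₀ ha₀ hxM, Subgroup.map_top_of_surjective _ hπ]
    · left
      rw [← Subgroup.map_comap_eq_self_of_surjective hπ M, hmax _ (hM.comap π) hle hxM,
        QuotientGroup.map_mk'_self]
  · refine mk_le_of_closure_eq_top hlam ?_ (hgen' j₀ j₁ hj h₁)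
    refine (mk_union_le _ _).trans (add_le_of_le hlam ?_ ?_)
    exacts [mk_range_le.trans h₀.le, mk_range_le.trans h₁.le]
  · rw [← h₀]
    exact mk_le_of_injective (hinj j₀)

open Cardinal in
theorem exists_simple {lam : Cardinal.{u}} (hlam : ℵ₀ ≤ lam) (hI : #I ≤ lam)
    (hH : ∀ i, #(H i) ≤ lam) [∀ i, Nontrivial (H i)] {j : I} (hj : #(H j) = lam) :
    ∃ (S : Type u) (_ : Group S), IsSimpleGroup S ∧ #S = lam ∧ ∃ φ : ∀ i, H i →* S,
      (∀ i, Injective (φ i)) ∧ ∀ i i' : I, i ≠ i' → #(H i') = lam →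
        Subgroup.closure (Set.range (φ i) ∪ Set.range (φ i')) = ⊤ := by
  let f : Option I → I := fun o => o.getD j
  obtain ⟨S, hS, hsimple, hcard, φ, hφ, hgen⟩ := exists_simple_of_two_large
    (I := Option I) (H := fun o => H (f o)) hlam
    (by rw [mk_option]; exact add_le_of_le hlam hI (one_le_aleph0.trans hlam))
    (fun o => hH _) (j₀ := none) (j₁ := some j) (by simp) hj hj
  exact ⟨S, hS, hsimple, hcard, fun i => φ (some i), fun i => hφ (some i),
    fun i i' hi hi' => hgen (some i) (some i') (by simpa using hi) hi'⟩

end SparseRelators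

/-- Theorem B: for an infinite cardinal `λ` and a family `(H i)` of nontrivial groups,
indexed by a set `I` with `2 ≤ |I| ≤ λ`, with `|H i| ≤ λ` for all `i` and `|H i| = λ`
for at least one `i`, there is a simple group `S` of cardinality `λ` containing a copy
of every `H i` and generated by the copies of `H i` and `H i'` whenever `i ≠ i'` and
`|H i'| = λ`. -/
theorem embedding_family_into_simple_group_of_cardinality
    (lam : Cardinal.{u}) (hlam : Cardinal.aleph0 ≤ lam)
    (I : Type u) (hI2 : 2 ≤ Cardinal.mk I) (hIlam : Cardinal.mk I ≤ lam)
    (H : I → Type u) [∀ i, Group (H i)] [∀ i, Nontrivial (H i)]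
    (hle : ∀ i, Cardinal.mk (H i) ≤ lam)
    (hach : ∃ i, Cardinal.mk (H i) = lam) :
    ∃ (S : Type u) (_ : Group S),
      IsSimpleGroup S ∧
      Cardinal.mk S = lam ∧
      ∃ φ : ∀ i, H i →* S,
        (∀ i, Function.Injective (φ i)) ∧
        ∀ i i' : I, i ≠ i' → Cardinal.mk (H i') = lam →
          Subgroup.closure (Set.range (φ i) ∪ Set.range (φ i')) = ⊤ := by
  obtain ⟨j, hj⟩ := hach
  exact SparseRelators.exists_simple hlam hIlam hle hj
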